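/- arXiv:1408.6022 — 2 statements merged into one kernel-verified Lean document; each statement's English description precedes it below -/
import Mathlib

section
/- Let μ be a finite positive measure on ℝ whose support is a finite set and with μ({0}) ≠ 0. Then there exist L ∈ (0,∞), a Hamiltonian H on [0,L], and a constant c ≥ 0 such that, with Θ(·,λ) and Φ(·,λ) the solutions of the canonical system J·Y' = λ·H·Y with initial values (1,0)ᵀ and (0,1)ᵀ, one has for every λ ∈ ℂ with Im λ > 0: Im( Φ₋(L,λ)/Θ₋(L,λ) ) = Im λ · ∫_ℝ dμ(t)/((t − Re λ)² + (Im λ)²) + c·Im λ. -/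
open MeasureTheory Complex
open scoped ENNReal ComplexOrder

noncomputable section


/-- The matrix `J = [[0,-1],[1,0]]` over `ℂ`. -/
def Jc : Matrix (Fin 2) (Fin 2) ℂ := !![0, -1; 1, 0]

/-- Complexification of a real 2×2 matrix. -/
def cplx (A : Matrix (Fin 2) (Fin 2) ℝ) : Matrix (Fin 2) (Fin 2) ℂ :=
  A.map (fun a => (a : ℂ))

/-- `Y` is a solution of the canonical system `J·Y' = z·H·Y` on the set `S`
with initial value `Y₀`, expressed via the equivalent integral equation. -/
def IsCanSol (H : ℝ → Matrix (Fin 2) (Fin 2) ℝ) (S : Set ℝ) (z : ℂ)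
    (Y₀ : Fin 2 → ℂ) (Y : ℝ → Fin 2 → ℂ) : Prop :=
  ContinuousOn Y S ∧
  ∀ x ∈ S, Jc.mulVec (Y x - Y₀) = z • ∫ t in (0:ℝ)..x, (cplx (H t)).mulVec (Y t)

/-- `H` is a Hamiltonian on the finite interval `[0,L]`. -/
def IsHamiltonian (H : ℝ → Matrix (Fin 2) (Fin 2) ℝ) (L : ℝ) : Prop :=
  (∀ i j, Measurable fun x => H x i j) ∧
  (∀ᵐ x ∂(volume.restrict (Set.Icc 0 L)), (H x).PosSemidef ∧ (H x).trace = 1) ∧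
  (∀ i j, IntegrableOn (fun x => H x i j) (Set.Icc 0 L))

/-- Transfer-matrix data of a Hamiltonian on `[0,L]`. -/
def TrData (L : ℝ) (H : ℝ → Matrix (Fin 2) (Fin 2) ℝ)
    (M : ℂ → Matrix (Fin 2) (Fin 2) ℂ) (Y : ℂ → (Fin 2 → ℂ) → ℝ → Fin 2 → ℂ) : Prop :=
  0 ≤ L ∧ IsHamiltonian H L ∧
  (∀ z y0, IsCanSol H (Set.Icc 0 L) z y0 (Y z y0) ∧
    IntervalIntegrable (fun t => (cplx (H t)).mulVec (Y z y0 t)) volume 0 L ∧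
    Y z y0 L = (M z).mulVec y0) ∧
  Continuous M ∧ M 0 = 1

lemma trData_zero : TrData 0 (fun _ => !![1, 0; 0, 0]) (fun _ => 1) (fun _ y0 _ => y0) := by
  refine ⟨le_rfl, ⟨fun i j => measurable_const, ?_, ?_⟩, ?_, continuous_const, rfl⟩
  · simp
  · intro i j; simp
  · intro z y0
    refine ⟨⟨continuousOn_const, ?_⟩, by simp, by simp⟩
    intro x hx
    have : x = 0 := by simpa using hx
    subst this
    simp

/-- The rank one Hamiltonian value. -/
def rk (a b : ℝ) : Matrix (Fin 2) (Fin 2) ℝ := !![a * a, a * b; b * a, b * b]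

/-- `J` times the rank one Hamiltonian value. -/
def jrk (a b : ℝ) : Matrix (Fin 2) (Fin 2) ℂ := !![-(b * a : ℂ), -(b * b : ℂ); (a * a : ℂ), (a * b : ℂ)]

lemma rk_psd (a b : ℝ) : (rk a b).PosSemidef := by
  have h := Matrix.posSemidef_vecMulVec_self_star (![a, b] : Fin 2 → ℝ)
  convert h using 1
  ext i j
  fin_cases i <;> fin_cases j <;> simp [rk, Matrix.vecMulVec]

lemma rk_jrk (a b : ℝ) (v : Fin 2 → ℂ) : (cplx (rk a b)).mulVec ((jrk a b).mulVec v) = 0 := by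
  ext i
  fin_cases i <;> simp [rk, jrk, cplx, Matrix.mulVec, dotProduct, Fin.sum_univ_two] <;> ring

lemma J_jrk (a b : ℝ) (v : Fin 2 → ℂ) : Jc.mulVec ((jrk a b).mulVec v) = - (cplx (rk a b)).mulVec v := by
  ext i
  fin_cases i <;> simp [rk, jrk, cplx, Jc, Matrix.mulVec, dotProduct, Fin.sum_univ_two] <;> ring

lemma trData_ext {L : ℝ} {H M Y} (h : TrData L H M Y) (a b l : ℝ) (hab : a * a + b * b = 1)
    (hl : 0 ≤ l) :
    TrData (L + l) (fun x => if x ≤ L then H x else rk a b)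
      (fun z => (1 - (z * l) • jrk a b) * M z)
      (fun z y0 x => Y z y0 (min x L) - (z * (max (x - L) 0 : ℝ)) • (jrk a b).mulVec (Y z y0 L)) := by
  obtain ⟨hL, ⟨hm, hps, hint⟩, hY, hMc, hM0⟩ := h
  refine ⟨by linarith, ⟨?_, ?_, ?_⟩, ?_, ?_, ?_⟩
  · intro i j
    have : (fun x => (if x ≤ L then H x else rk a b) i j) =
        fun x => if x ≤ L then H x i j else rk a b i j := by
      ext x; split_ifs <;> rfl
    simp only [this]
    exact Measurable.ite measurableSet_Iic (hm i j) measurable_const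
  · rw [ae_restrict_iff' measurableSet_Icc] at hps ⊢
    filter_upwards [hps] with x hx hx'
    by_cases hxL : x ≤ L
    · simpa [hxL] using hx ⟨hx'.1, hxL⟩
    · simp only [hxL, if_false]
      exact ⟨rk_psd a b, by simpa [rk, Matrix.trace, Fin.sum_univ_two] using hab⟩
  · intro i j
    have hsub : Set.Icc 0 (L + l) ⊆ Set.Icc 0 L ∪ Set.Ioc L (L + l) := by
      intro x hx
      by_cases hxL : x ≤ L
      · exact Or.inl ⟨hx.1, hxL⟩
      · exact Or.inr ⟨not_le.1 hxL, hx.2⟩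
    refine IntegrableOn.mono_set (IntegrableOn.union ?_ ?_) hsub
    · refine (hint i j).congr_fun ?_ measurableSet_Icc
      intro x hx
      simp [hx.2]
    · refine IntegrableOn.congr_fun (f := fun _ => rk a b i j) ?_ ?_ measurableSet_Ioc
      · simp
      · intro x hx
        simp [not_le.2 hx.1]
  · intro z y0
    obtain ⟨⟨hc, hs⟩, hi, he⟩ := hY z y0
    set Q := jrk a b
    have hi1 : ∀ x ∈ Set.Icc 0 L, IntervalIntegrable (fun t => (cplx (if t ≤ L then H t else rk a b)).mulVec
        (Y z y0 (min t L) - (z * (max (t - L) 0 : ℝ)) • Q.mulVec (Y z y0 L))) volume 0 x ∧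
        (∫ t in (0:ℝ)..x, (cplx (if t ≤ L then H t else rk a b)).mulVec
        (Y z y0 (min t L) - (z * (max (t - L) 0 : ℝ)) • Q.mulVec (Y z y0 L))) =
        ∫ t in (0:ℝ)..x, (cplx (H t)).mulVec (Y z y0 t) := by
      intro x hx
      have key : ∀ t ∈ Set.uIcc 0 x, (cplx (if t ≤ L then H t else rk a b)).mulVec
        (Y z y0 (min t L) - (z * (max (t - L) 0 : ℝ)) • Q.mulVec (Y z y0 L)) =
          (cplx (H t)).mulVec (Y z y0 t) := by
        intro t ht
        rw [Set.uIcc_of_le hx.1] at ht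
        have htL : t ≤ L := ht.2.trans hx.2
        simp [htL]
      refine ⟨?_, intervalIntegral.integral_congr key⟩
      have h1 : IntervalIntegrable (fun t => (cplx (H t)).mulVec (Y z y0 t)) volume 0 x := by
        refine hi.mono_set ?_
        rw [Set.uIcc_of_le hx.1, Set.uIcc_of_le hL]
        exact Set.Icc_subset_Icc le_rfl hx.2
      refine h1.congr ?_
      intro t ht
      exact (key t (Set.uIoc_subset_uIcc ht)).symm
    have hi2 : ∀ x, L ≤ x → IntervalIntegrable (fun t => (cplx (if t ≤ L then H t else rk a b)).mulVec
        (Y z y0 (min t L) - (z * (max (t - L) 0 : ℝ)) • Q.mulVec (Y z y0 L))) volume L x ∧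
        (∫ t in L..x, (cplx (if t ≤ L then H t else rk a b)).mulVec
        (Y z y0 (min t L) - (z * (max (t - L) 0 : ℝ)) • Q.mulVec (Y z y0 L))) =
        ∫ t in L..x, (cplx (rk a b)).mulVec (Y z y0 L) := by
      intro x hx
      have key : ∀ t ∈ Set.uIoc L x, (cplx (if t ≤ L then H t else rk a b)).mulVec
        (Y z y0 (min t L) - (z * (max (t - L) 0 : ℝ)) • Q.mulVec (Y z y0 L)) =
          (cplx (rk a b)).mulVec (Y z y0 L) := by
        intro t ht
        rw [Set.uIoc_of_le hx] at ht
        rw [if_neg (not_le.2 ht.1), min_eq_right ht.1.le, Matrix.mulVec_sub, Matrix.mulVec_smul,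
          rk_jrk]
        simp
      refine ⟨?_, ?_⟩
      · refine IntervalIntegrable.congr (f := fun _ => (cplx (rk a b)).mulVec (Y z y0 L)) ?_ intervalIntegrable_const
        intro t ht
        exact (key t ht).symm
      · refine intervalIntegral.integral_congr_ae ?_
        exact Filter.Eventually.of_forall key
    refine ⟨⟨?_, ?_⟩, ?_, ?_⟩
    · refine ContinuousOn.sub (hc.comp (by fun_prop) ?_) (by fun_prop)
      intro x hx
      exact ⟨le_min hx.1 hL, min_le_right _ _⟩
    · intro x hx
      by_cases hxL : x ≤ L
      · rw [(hi1 x ⟨hx.1, hxL⟩).2, ← hs x ⟨hx.1, hxL⟩]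
        simp [hxL]
      · have hxL' := (not_le.1 hxL).le
        have hL1 := hi1 L ⟨hL, le_rfl⟩
        rw [← intervalIntegral.integral_add_adjacent_intervals hL1.1 (hi2 x hxL').1, hL1.2,
          (hi2 x hxL').2, smul_add, ← hs L ⟨hL, le_rfl⟩, intervalIntegral.integral_const]
        beta_reduce
        rw [min_eq_right hxL', max_eq_left (by linarith), sub_right_comm, sub_eq_add_neg _ (_ • _),
          Matrix.mulVec_add, Matrix.mulVec_neg, Matrix.mulVec_smul, J_jrk]
        congr 1
        rw [smul_neg, neg_neg, mul_smul]
        rfl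
    · have hL1 := hi1 L ⟨hL, le_rfl⟩
      exact hL1.1.trans (hi2 (L + l) (by linarith)).1
    · beta_reduce
      rw [min_eq_right (by linarith), add_sub_cancel_left, max_eq_left hl, he, Matrix.mulVec_mulVec,
        ← Matrix.smul_mulVec, ← Matrix.sub_mulVec, sub_mul, one_mul, Matrix.smul_mul]
  · have : Continuous fun z : ℂ => (1 - (z * l) • jrk a b) := by fun_prop
    exact this.mul hMc
  · simp [hM0]

/-- Lanczos recursion. -/
def lz {E : Type*} [NormedAddCommGroup E] [InnerProductSpace ℝ E] (T : E →ₗ[ℝ] E) (v0 : E) :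
    ℕ → E × E
  | 0 => (0, v0)
  | n + 1 =>
    let p := lz T v0 n
    let nu : ℝ := inner ℝ p.2 p.2
    (-(nu⁻¹ • p.2), T p.2 - ((inner ℝ (T p.2) p.2 : ℝ) / nu) • p.2 + nu • p.1)

section
variable {E : Type*} [NormedAddCommGroup E] [InnerProductSpace ℝ E] (T : E →ₗ[ℝ] E) (v0 : E)

lemma lz_fst (n : ℕ) : (lz T v0 (n + 1)).1 =
    -((inner ℝ (lz T v0 n).2 (lz T v0 n).2 : ℝ)⁻¹ • (lz T v0 n).2) := rfl

lemma lz_snd (n : ℕ) : (lz T v0 (n + 1)).2 = T (lz T v0 n).2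
    - ((inner ℝ (T (lz T v0 n).2) (lz T v0 n).2 : ℝ) / (inner ℝ (lz T v0 n).2 (lz T v0 n).2 : ℝ))
      • (lz T v0 n).2 + (inner ℝ (lz T v0 n).2 (lz T v0 n).2 : ℝ) • (lz T v0 n).1 := rfl

lemma lz_orth (hT : T.IsSymmetric) (n : ℕ) (hne : ∀ k < n, (lz T v0 k).2 ≠ 0) :
    ∀ j, j ≤ n → ∀ i, i < j → (inner ℝ (lz T v0 i).2 (lz T v0 j).2 : ℝ) = 0 := by
  induction n with
  | zero => intro j hj i hi; omega
  | succ n ih =>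
    have hnn : ∀ k < n + 1, (inner ℝ (lz T v0 k).2 (lz T v0 k).2 : ℝ) ≠ 0 := fun k hk =>
      inner_self_ne_zero.2 (hne k hk)
    replace ih := ih fun k hk => hne k (by omega)
    intro j hj i hi
    rcases Nat.lt_or_ge j (n + 1) with h | h
    · exact ih j (by omega) i hi
    obtain rfl : j = n + 1 := by omega
    -- orthogonality to the first components
    have hu : ∀ k, k ≤ n → (inner ℝ (lz T v0 k).1 (lz T v0 n).2 : ℝ) = 0 := by
      intro k hk
      cases k with
      | zero => simp [lz]
      | succ k =>
        rw [lz_fst, inner_neg_left, inner_smul_left, ih n le_rfl k (by omega)]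
        simp
    have hTs : (inner ℝ (lz T v0 i).2 (T (lz T v0 n).2) : ℝ) = inner ℝ (T (lz T v0 i).2) (lz T v0 n).2 :=
      (hT _ _).symm
    rw [lz_snd, inner_add_right, inner_sub_right, inner_smul_right, inner_smul_right, hTs]
    rcases Nat.lt_or_ge i n with hin | hin
    · have h1 : T (lz T v0 i).2 = (lz T v0 (i + 1)).2
          + ((inner ℝ (T (lz T v0 i).2) (lz T v0 i).2 : ℝ) / (inner ℝ (lz T v0 i).2 (lz T v0 i).2 : ℝ))
            • (lz T v0 i).2 - (inner ℝ (lz T v0 i).2 (lz T v0 i).2 : ℝ) • (lz T v0 i).1 := by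
        rw [lz_snd]; abel
      have h2 : (inner ℝ (T (lz T v0 i).2) (lz T v0 n).2 : ℝ)
          = inner ℝ (lz T v0 (i + 1)).2 (lz T v0 n).2 := by
        conv_lhs => rw [h1]
        rw [inner_sub_left, inner_add_left, inner_smul_left, inner_smul_left,
          ih n le_rfl i hin, hu i hin.le]
        simp
      rw [h2, ih n le_rfl i hin]
      obtain ⟨m, rfl⟩ : ∃ m, n = m + 1 := ⟨n - 1, by omega⟩
      rw [lz_fst T v0 m, inner_neg_right, inner_smul_right]
      rcases Nat.lt_or_ge i m with him | him
      · rw [ih (m + 1) le_rfl (i + 1) (by omega), ih m (by omega) i him]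
        simp
      · obtain rfl : i = m := by omega
        have := hnn i (by omega)
        field_simp
        ring
    · obtain rfl : i = n := by omega
      rw [real_inner_comm (lz T v0 i).1, hu i le_rfl]
      have := hnn i (by omega)
      field_simp
      ring

lemma lz_term [FiniteDimensional ℝ E] (hT : T.IsSymmetric) : ∃ n, (lz T v0 n).2 = 0 := by
  by_contra! hne
  refine Module.Finite.not_linearIndependent_of_infinite (R := ℝ) (fun n => (lz T v0 n).2)
    (linearIndependent_of_ne_zero_of_inner_eq_zero hne ?_)
  intro i j hij
  rcases lt_or_gt_of_ne hij with h | h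
  · exact lz_orth T v0 hT j (fun k _ => hne k) j le_rfl i h
  · exact (real_inner_comm _ _).trans (lz_orth T v0 hT i (fun k _ => hne k) i le_rfl j h)
end

lemma chain (n : ℕ) (α ν : ℕ → ℝ) (hν : ∀ k < n, 0 < ν k) (X Y : ℕ → ℂ → ℂ) (U : Set ℂ)
    (hX : ∀ k < n, ∀ z ∈ U, X (k + 1) z = -(Y k z) / ν k)
    (hY : ∀ k < n, ∀ z ∈ U, Y (k + 1) z = (z - α k) * Y k z + ν k * X k z) :
    ∀ k ≤ n, ∃ p q r s : ℝ, p * s - q * r = 1 ∧ ∃ L H M Yy, TrData L H M Yy ∧ ∀ z ∈ U,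
      X 0 z = (X k z * p + Y k z * r) * M z 0 0 + (X k z * q + Y k z * s) * M z 1 0 ∧
      Y 0 z = (X k z * p + Y k z * r) * M z 0 1 + (X k z * q + Y k z * s) * M z 1 1 := by
  intro k
  induction k with
  | zero =>
    intro _
    refine ⟨1, 0, 0, 1, by norm_num, _, _, _, _, trData_zero, ?_⟩
    intro z hz
    simp
  | succ k ih =>
    intro hk
    obtain ⟨p, q, r, s, hdet, L, H, M, Yy, hT, hM⟩ := ih (by omega)
    have hνk := hν k (by omega)
    have hpos : 0 < p * p + q * q := by
      by_contra hcon
      have hp : p = 0 := by nlinarith [mul_self_nonneg p, mul_self_nonneg q]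
      have hq : q = 0 := by nlinarith [mul_self_nonneg p, mul_self_nonneg q]
      simp [hp, hq] at hdet
    set ρ := Real.sqrt (p * p + q * q) with hρ
    have hρ0 : 0 < ρ := Real.sqrt_pos.2 hpos
    have hρ2 : ρ * ρ = p * p + q * q := Real.mul_self_sqrt hpos.le
    have hT' := trData_ext hT (p / ρ) (q / ρ) (ρ * ρ / ν k) (by
      field_simp
      nlinarith) (by positivity)
    refine ⟨-α k * p - ν k * r, -α k * q - ν k * s, p / ν k, q / ν k, ?_, _, _, _, _, hT', ?_⟩
    · field_simp
      linear_combination ν k * hdet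
    · intro z hz
      have hνc : (ν k : ℂ) ≠ 0 := by exact_mod_cast hνk.ne'
      have hρc : (ρ : ℂ) ≠ 0 := by exact_mod_cast hρ0.ne'
      have hdc : (p : ℂ) * s - q * r = 1 := by exact_mod_cast hdet
      have hE : ∀ i j, ((1 - (z * ((ρ * ρ / ν k : ℝ) : ℂ)) • jrk (p / ρ) (q / ρ)) * M z) i j =
          M z i j - z / ν k * ((!![-(q * p : ℂ), -(q * q : ℂ); (p * p : ℂ), (p * q : ℂ)] :
            Matrix (Fin 2) (Fin 2) ℂ) * M z) i j := by
        intro i j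
        have : (z * ((ρ * ρ / ν k : ℝ) : ℂ)) • jrk (p / ρ) (q / ρ) =
            (z / ν k) • (!![-(q * p : ℂ), -(q * q : ℂ); (p * p : ℂ), (p * q : ℂ)] :
            Matrix (Fin 2) (Fin 2) ℂ) := by
          ext i j
          fin_cases i <;> fin_cases j <;> simp [jrk] <;> field_simp
        rw [this, sub_mul, one_mul, Matrix.smul_mul, Matrix.sub_apply, Matrix.smul_apply, smul_eq_mul]
      simp only [hE, hX k (by omega) z hz, hY k (by omega) z hz]
      obtain ⟨h1, h2⟩ := hM z hz
      rw [h1, h2]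
      simp only [Matrix.mul_apply, Fin.sum_univ_two]
      simp
      constructor
      · linear_combination (norm := (field_simp; ring))
          (z * Y k z / ν k * (p * M z 0 0 + q * M z 1 0)) * hdc
      · linear_combination (norm := (field_simp; ring))
          (z * Y k z / ν k * (p * M z 0 1 + q * M z 1 1)) * hdc

lemma main_real (S : Finset ℝ) (m : ℝ → ℝ) (hm : ∀ t, 0 ≤ m t) (h0S : (0 : ℝ) ∈ S)
    (h0 : m 0 ≠ 0) :
    ∃ L H M Yy, TrData L H M Yy ∧ ∀ z : ℂ, 0 < z.im →
      M z 1 0 ≠ 0 ∧ M z 1 1 / M z 1 0 = ∑ t ∈ S, (m t : ℂ) / (t - z) := by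
  classical
  let T : EuclideanSpace ℝ S →ₗ[ℝ] EuclideanSpace ℝ S :=
    { toFun := fun v => WithLp.toLp 2 fun t => (t : ℝ) * v t
      map_add' := by intro u v; ext t; simp [mul_add]
      map_smul' := by intro c v; ext t; simp; ring }
  have hT : T.IsSymmetric := by
    intro u v
    simp only [PiLp.inner_apply, T]
    refine Finset.sum_congr rfl fun t _ => ?_
    simp
    ring
  let v0 : EuclideanSpace ℝ S := WithLp.toLp 2 fun t => Real.sqrt (m t)
  let σ : ℂ → EuclideanSpace ℝ S → ℂ := fun z v => ∑ t : S, (Real.sqrt (m t) * v t : ℂ) / ((t : ℝ) - z)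
  have hσadd : ∀ z u v, σ z (u + v) = σ z u + σ z v := by
    intro z u v
    simp only [σ, ← Finset.sum_add_distrib]
    refine Finset.sum_congr rfl fun t _ => ?_
    simp; ring
  have hσsmul : ∀ z (c : ℝ) v, σ z (c • v) = c * σ z v := by
    intro z c v
    simp only [σ, Finset.mul_sum]
    refine Finset.sum_congr rfl fun t _ => ?_
    simp; ring
  have hσneg : ∀ z v, σ z (-v) = - σ z v := by
    intro z v
    have := hσsmul z (-1) v
    simpa using this
  have hne : ∀ z : ℂ, 0 < z.im → ∀ t : ℝ, (t : ℂ) - z ≠ 0 := by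
    intro z hz t h
    have := congrArg Complex.im h
    simp at this
    linarith
  have hσT : ∀ z : ℂ, 0 < z.im → ∀ v, σ z (T v) = z * σ z v + (inner ℝ v0 v : ℝ) := by
    intro z hz v
    simp only [σ, Finset.mul_sum, PiLp.inner_apply, Complex.ofReal_sum, ← Finset.sum_add_distrib]
    refine Finset.sum_congr rfl fun t _ => ?_
    have := hne z hz t
    simp [T, v0]
    field_simp
    ring
  obtain ⟨n, hn, hmin⟩ : ∃ n, (lz T v0 n).2 = 0 ∧ ∀ k < n, (lz T v0 k).2 ≠ 0 := by
    have h := lz_term T v0 hT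
    exact ⟨Nat.find h, Nat.find_spec h, fun k hk => Nat.find_min h hk⟩
  let α : ℕ → ℝ := fun k => (inner ℝ (T (lz T v0 k).2) (lz T v0 k).2 : ℝ) /
    (inner ℝ (lz T v0 k).2 (lz T v0 k).2 : ℝ)
  let ν : ℕ → ℝ := fun k => (inner ℝ (lz T v0 k).2 (lz T v0 k).2 : ℝ)
  let X : ℕ → ℂ → ℂ := fun k z => if k = 0 then 1 else σ z (lz T v0 k).1
  let Y : ℕ → ℂ → ℂ := fun k z => σ z (lz T v0 k).2
  obtain ⟨p, q, r, s, hdet, L, H, M, Yy, hTr, hM⟩ := chain n α ν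
    (fun k hk => real_inner_self_pos.2 (hmin k hk)) X Y {z | 0 < z.im}
    (by
      intro k hk z hz
      simp only [X, Y, ν, lz_fst, hσneg, hσsmul, Nat.succ_ne_zero, if_false]
      push_cast
      ring)
    (by
      intro k hk z hz
      simp only [X, Y, ν, α, lz_snd, sub_eq_add_neg, hσadd, hσneg, hσsmul, hσT z hz]
      rcases Nat.eq_zero_or_pos k with rfl | hk0
      · have : σ z (lz T v0 0).1 = 0 := by
          simp [lz, σ]
        rw [this]
        simp only [if_true, lz]
        ring
      · have h := lz_orth T v0 hT k (fun j hj => hmin j (by omega)) k le_rfl 0 hk0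
        have h' : (inner ℝ v0 (lz T v0 k).2 : ℝ) = 0 := h
        rw [h', if_neg (by omega)]
        push_cast
        ring) n le_rfl
  have hYn : ∀ z, Y n z = 0 := by
    intro z
    simp [Y, hn, σ]
  have hX0 : ∀ z, X 0 z = 1 := fun z => by simp [X]
  have hY0 : ∀ z, Y 0 z = ∑ t ∈ S, (m t : ℂ) / (t - z) := by
    intro z
    rw [← Finset.sum_coe_sort S]
    simp only [Y, σ, lz, v0]
    refine Finset.sum_congr rfl fun t _ => ?_
    rw [← Complex.ofReal_mul, Real.mul_self_sqrt (hm _)]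
  simp only [hYn, hX0, hY0, zero_mul, add_zero] at hM
  have hrel : ∀ z : ℂ, 0 < z.im → (∑ t ∈ S, (m t : ℂ) / (t - z)) * (p * M z 0 0 + q * M z 1 0)
      = p * M z 0 1 + q * M z 1 1 := by
    intro z hz
    obtain ⟨h1, h2⟩ := hM z hz
    rw [h2]
    linear_combination (-(p * M z 0 1 + q * M z 1 1)) * h1
  have hp : p = 0 := by
    have hMc := hTr.2.2.2.1
    have hM0 := hTr.2.2.2.2
    let w : ℝ → ℂ := fun ε => ε * Complex.I
    have hw : Filter.Tendsto w (nhdsWithin 0 (Set.Ioi 0)) (nhds 0) := by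
      have : Continuous w := by fun_prop
      have h := this.tendsto 0
      simp only [w, Complex.ofReal_zero, zero_mul] at h
      exact h.mono_left nhdsWithin_le_nhds
    have hent : ∀ i j, Filter.Tendsto (fun ε => M (w ε) i j) (nhdsWithin 0 (Set.Ioi 0))
        (nhds ((1 : Matrix (Fin 2) (Fin 2) ℂ) i j)) := by
      intro i j
      have h1 : Continuous fun z => M z i j := (hMc.matrix_elem i j)
      have h2 := (h1.tendsto 0).comp hw
      rw [hM0] at h2
      exact h2
    have hf : Filter.Tendsto (fun ε => ∑ t ∈ S, w ε * ((m t : ℂ) / (t - w ε)))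
        (nhdsWithin 0 (Set.Ioi 0)) (nhds (∑ t ∈ S, if t = 0 then -(m 0 : ℂ) else 0)) := by
      refine tendsto_finsetSum S fun t _ => ?_
      split_ifs with ht
      · refine tendsto_const_nhds.congr' ?_
        filter_upwards [self_mem_nhdsWithin] with ε hε
        have hε0 : (ε : ℂ) ≠ 0 := by exact_mod_cast (ne_of_gt hε)
        have hw0 : w ε ≠ 0 := mul_ne_zero hε0 Complex.I_ne_zero
        rw [ht]
        simp only [Complex.ofReal_zero, zero_sub]
        field_simp
      · have htc : (t : ℂ) - 0 ≠ 0 := by simpa using ht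
        have := hw.mul ((tendsto_const_nhds (x := (m t : ℂ))).div
          ((tendsto_const_nhds (x := (t : ℂ))).sub hw) htc)
        simpa using this
    have hl := hf.mul (((hent 0 0).const_mul (p : ℂ)).add ((hent 1 0).const_mul (q : ℂ)))
    have hr := hw.mul (((hent 0 1).const_mul (p : ℂ)).add ((hent 1 1).const_mul (q : ℂ)))
    have heq := tendsto_nhds_unique_of_eventuallyEq hl hr (by
      filter_upwards [self_mem_nhdsWithin] with ε hε
      have him : 0 < (w ε).im := by simpa [w] using hε
      rw [← hrel (w ε) him, ← Finset.mul_sum]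
      ring)
    simp [h0S, h0] at heq
    exact heq
  refine ⟨L, H, M, Yy, hTr, ?_⟩
  intro z hz
  obtain ⟨h1, h2⟩ := hM z hz
  rw [hp] at h1
  have hM10 : M z 1 0 ≠ 0 := by
    intro h
    simp [h] at h1
  refine ⟨hM10, ?_⟩
  have hq : (q : ℂ) ≠ 0 := by
    intro h
    simp [h] at h1
  have h3 := hrel z hz
  rw [hp] at h3
  rw [div_eq_iff hM10]
  simp only [Complex.ofReal_zero, zero_mul, zero_add] at h3
  apply mul_left_cancel₀ hq
  rw [← h3]
  ring

theorem stmt3 (μ : Measure ℝ) [IsFiniteMeasure μ]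
    (hfin : ∃ S : Finset ℝ, μ ((S : Set ℝ)ᶜ) = 0) (h0 : μ {0} ≠ 0) :
    ∃ (L : ℝ) (H : ℝ → Matrix (Fin 2) (Fin 2) ℝ) (c : ℝ)
      (Θ Φ : ℂ → ℝ → Fin 2 → ℂ),
      0 < L ∧ IsHamiltonian H L ∧ 0 ≤ c ∧
      (∀ z : ℂ, IsCanSol H (Set.Icc 0 L) z ![1, 0] (Θ z)) ∧
      (∀ z : ℂ, IsCanSol H (Set.Icc 0 L) z ![0, 1] (Φ z)) ∧
      ∀ lam : ℂ, 0 < lam.im →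
        (Φ lam L 1 / Θ lam L 1).im
          = lam.im * ∫ t, (1 / ((t - lam.re) ^ 2 + lam.im ^ 2)) ∂μ + c * lam.im := by
  obtain ⟨S, hS⟩ := hfin
  have h0S : (0 : ℝ) ∈ S := by
    by_contra h
    apply h0
    refine measure_mono_null ?_ hS
    intro x hx
    rw [Set.mem_singleton_iff] at hx
    subst hx
    simpa using h
  have hm0 : μ.real {0} ≠ 0 := by
    rw [measureReal_def, ENNReal.toReal_ne_zero]
    exact ⟨h0, measure_ne_top _ _⟩
  obtain ⟨L, H, M, Yy, hTr, hM⟩ := main_real S (fun t => μ.real {t}) (fun t => measureReal_nonneg)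
    h0S hm0
  obtain ⟨hL, hH, hY, hMc, hM0⟩ := hTr
  have hLpos : 0 < L := by
    rcases hL.lt_or_eq with h | h
    · exact h
    exfalso
    subst h
    have h1 := hY Complex.I ![1, 0]
    have h2 := h1.1.2 0 ⟨le_rfl, le_rfl⟩
    rw [intervalIntegral.integral_same, smul_zero, h1.2.2] at h2
    have h3 := congrFun h2 0
    simp [Jc, Matrix.mulVec, dotProduct, Fin.sum_univ_two] at h3
    exact (hM Complex.I (by simp)).1 h3
  refine ⟨L, H, 0, fun z => Yy z ![1, 0], fun z => Yy z ![0, 1], hLpos, hH, le_rfl,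
    fun z => (hY z _).1, fun z => (hY z _).1, ?_⟩
  intro z hz
  have e1 : Yy z ![0, 1] L 1 = M z 1 1 := by
    rw [(hY z _).2.2]; simp [Matrix.mulVec, dotProduct, Fin.sum_univ_two]
  have e2 : Yy z ![1, 0] L 1 = M z 1 0 := by
    rw [(hY z _).2.2]; simp [Matrix.mulVec, dotProduct, Fin.sum_univ_two]
  beta_reduce
  rw [e1, e2, (hM z hz).2]
  have hrestr : μ.restrict (S : Set ℝ) = μ := Measure.restrict_eq_self_of_ae_mem hS
  have hint : ∫ t, (1 / ((t - z.re) ^ 2 + z.im ^ 2)) ∂μ =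
      ∑ t ∈ S, μ.real {t} * (1 / ((t - z.re) ^ 2 + z.im ^ 2)) := by
    conv_lhs => rw [← hrestr]
    rw [setIntegral_finset]
    · simp
    · exact IntegrableOn.finset
  rw [hint, Complex.im_sum, Finset.mul_sum, zero_mul, add_zero]
  refine Finset.sum_congr rfl fun t _ => ?_
  have hpos : 0 < (t - z.re) ^ 2 + z.im ^ 2 := by positivity
  rw [Complex.div_im]
  have hns : Complex.normSq ((t : ℂ) - z) = (t - z.re) ^ 2 + z.im ^ 2 := by
    simp [Complex.normSq_apply]; ring
  rw [hns]
  simp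
  field_simp

end
end

section
/- Let q, q̃ ∈ L¹(0,1) be real-valued, let h, h̃ ∈ ℝ, and let h₁, h₂, h̃₁, h̃₂ ∈ ℝ ∪ {∞} with h₁ ≠ h₂. If σ(q; h, h₁) = σ(q̃; h̃, h̃₁) and σ(q; h, h₂) = σ(q̃; h̃, h̃₂), then q = q̃ a.e. on (0,1), h = h̃, h₁ = h̃₁, and h₂ = h̃₂. -/
open MeasureTheory Complex
open scoped ENNReal ComplexOrder

noncomputable section


/-- `u` (with derivative `u'`) is a solution of `-u'' + q·u = λ·u` on `[0,1]`,
with `u` and `u'` absolutely continuous. -/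
def IsSchrodingerSol (q : ℝ → ℝ) (lam : ℝ) (u u' : ℝ → ℝ) : Prop :=
  ContinuousOn u (Set.Icc 0 1) ∧ ContinuousOn u' (Set.Icc 0 1) ∧
  IntegrableOn u' (Set.Icc 0 1) ∧
  IntegrableOn (fun t => q t * u t - lam * u t) (Set.Icc 0 1) ∧
  (∀ x ∈ Set.Icc (0:ℝ) 1, u x = u 0 + ∫ t in (0:ℝ)..x, u' t) ∧
  (∀ x ∈ Set.Icc (0:ℝ) 1, u' x = u' 0 + ∫ t in (0:ℝ)..x, (q t * u t - lam * u t))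

/-- The boundary condition `u'(1) = h'·u(1)` at the right endpoint, where
`h' ∈ ℝ ∪ {∞}` and `h' = ∞` (i.e. `none`) means `u(1) = 0`. -/
def RightBC (h' : Option ℝ) (u u' : ℝ → ℝ) : Prop :=
  h'.elim (u 1 = 0) (fun c => u' 1 = c * u 1)

/-- The spectrum `σ(q; h, h')` of `-d²/dx² + q` on `[0,1]` with boundary
conditions `u'(0) = h·u(0)` and `u'(1) = h'·u(1)`. -/
def SchrodingerSpec (q : ℝ → ℝ) (h : ℝ) (h' : Option ℝ) : Set ℝ :=
  {lam : ℝ | ∃ u u' : ℝ → ℝ, IsSchrodingerSol q lam u u' ∧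
    (¬ ∀ x ∈ Set.Icc (0:ℝ) 1, u x = 0) ∧
    u' 0 = h * u 0 ∧ RightBC h' u u'}


/-- `F` is a primitive of the integrable function `f` on `[0,1]`. -/
def IsPrim {𝕜 : Type*} [RCLike 𝕜] (f F : ℝ → 𝕜) : Prop :=
  IntervalIntegrable f volume 0 1 ∧ ∀ x ∈ Set.Icc (0:ℝ) 1, F x = F 0 + ∫ t in (0:ℝ)..x, f t

section prim
variable {𝕜 : Type*} [RCLike 𝕜] {f g F G : ℝ → 𝕜}

lemma intervalIntegrable_sub01 {E : Type*} [NormedAddCommGroup E] {f : ℝ → E}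
    (hf : IntervalIntegrable f volume 0 1) {x : ℝ}
    (hx : x ∈ Set.Icc (0:ℝ) 1) : IntervalIntegrable f volume 0 x := by
  apply hf.mono_set
  rw [Set.uIcc_of_le hx.1, Set.uIcc_of_le zero_le_one]
  exact Set.Icc_subset_Icc le_rfl hx.2

lemma ac_integral (hf : IntervalIntegrable f volume 0 1) :
    AbsolutelyContinuousOnInterval (fun x => ∫ t in (0:ℝ)..x, f t) 0 1 := by
  have h1 : IntervalIntegrable (fun t => RCLike.re (f t)) volume 0 1 := by
    have := hf
    rw [intervalIntegrable_iff] at this ⊢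
    exact this.re
  have h2 : IntervalIntegrable (fun t => RCLike.im (f t)) volume 0 1 := by
    have := hf
    rw [intervalIntegrable_iff] at this ⊢
    exact this.im
  have a1 := h1.absolutelyContinuousOnInterval_intervalIntegral (c := 0) (by simp)
  have a2 := h2.absolutelyContinuousOnInterval_intervalIntegral (c := 0) (by simp)
  have c1 : AbsolutelyContinuousOnInterval (fun _ : ℝ => (1 : 𝕜)) 0 1 :=
    (contDiff_const (n := 1)).contDiffOn.absolutelyContinuousOnInterval
  have c2 : AbsolutelyContinuousOnInterval (fun _ : ℝ => (RCLike.I : 𝕜)) 0 1 :=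
    (contDiff_const (n := 1)).contDiffOn.absolutelyContinuousOnInterval
  have := (a1.fun_smul c1).fun_add (a2.fun_smul c2)
  rw [absolutelyContinuousOnInterval_iff] at this ⊢
  intro ε hε
  obtain ⟨δ, hδ, H⟩ := this ε hε
  refine ⟨δ, hδ, fun E hE hs => ?_⟩
  refine lt_of_le_of_lt (le_of_eq ?_) (H E hE hs)
  have key : ∀ x ∈ Set.uIcc (0:ℝ) 1, (∫ t in (0:ℝ)..x, f t) =
      (∫ t in (0:ℝ)..x, RCLike.re (f t)) • (1:𝕜) + (∫ t in (0:ℝ)..x, RCLike.im (f t)) • (RCLike.I : 𝕜) := by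
    intro x hx
    rw [Set.uIcc_of_le zero_le_one] at hx
    have hfx := intervalIntegrable_sub01 hf hx
    rw [intervalIntegral.integral_of_le hx.1, intervalIntegral.integral_of_le hx.1,
      intervalIntegral.integral_of_le hx.1]
    have hi : IntegrableOn f (Set.Ioc 0 x) := by
      have := hfx
      rwa [intervalIntegrable_iff_integrableOn_Ioc_of_le hx.1] at this
    have := integral_re_add_im hi
    rw [← this]
    simp [RCLike.real_smul_eq_coe_mul]
  refine Finset.sum_congr rfl fun i hi => ?_
  have := hE.1 i hi
  rw [key _ this.1, key _ this.2]

lemma IsPrim.ac (h : IsPrim f F) : AbsolutelyContinuousOnInterval F 0 1 := by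
  have c1 : AbsolutelyContinuousOnInterval (fun _ : ℝ => F 0) 0 1 :=
    (contDiff_const (n := 1)).contDiffOn.absolutelyContinuousOnInterval
  have := c1.fun_add (ac_integral h.1)
  rw [absolutelyContinuousOnInterval_iff] at this ⊢
  intro ε hε
  obtain ⟨δ, hδ, H⟩ := this ε hε
  refine ⟨δ, hδ, fun E hE hs => ?_⟩
  refine lt_of_le_of_lt (le_of_eq ?_) (H E hE hs)
  refine Finset.sum_congr rfl fun i hi => ?_
  have := hE.1 i hi
  rw [Set.uIcc_of_le zero_le_one] at this
  rw [h.2 _ this.1, h.2 _ this.2]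

lemma IsPrim.continuousOn (h : IsPrim f F) : ContinuousOn F (Set.Icc 0 1) := by
  have := h.ac.continuousOn
  rwa [Set.uIcc_of_le zero_le_one] at this

lemma ae_interior : ∀ᵐ x : ℝ, x ∈ Set.Icc (0:ℝ) 1 → x ∈ Set.Ioo (0:ℝ) 1 := by
  have h₁ : ∀ᵐ x : ℝ, x ≠ 0 := by simp [ae_iff, measure_singleton]
  have h₂ : ∀ᵐ x : ℝ, x ≠ 1 := by simp [ae_iff, measure_singleton]
  filter_upwards [h₁, h₂] with x a b c
  exact ⟨lt_of_le_of_ne c.1 a.symm, lt_of_le_of_ne c.2 b⟩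

lemma IsPrim.ae_deriv (h : IsPrim f F) :
    ∀ᵐ x : ℝ, x ∈ Set.Icc (0:ℝ) 1 → HasDerivAt F (f x) x := by
  filter_upwards [ae_interior, h.1.ae_hasDerivAt_integral] with x h1 h2 h3
  have := (h2 (by rwa [Set.uIcc_of_le zero_le_one]) 0 (by simp)).const_add (F 0)
  refine this.congr_of_eventuallyEq ?_
  filter_upwards [Ioo_mem_nhds (h1 h3).1 (h1 h3).2] with y hy
  exact h.2 y ⟨hy.1.le, hy.2.le⟩

lemma isPrim_of_ac (hf : IntervalIntegrable f volume 0 1) (hF : AbsolutelyContinuousOnInterval F 0 1)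
    (hd : ∀ᵐ x : ℝ, x ∈ Set.Icc (0:ℝ) 1 → HasDerivAt F (f x) x) : IsPrim f F := by
  refine ⟨hf, ?_⟩
  have hac := hF.fun_sub (ac_integral hf)
  obtain ⟨C, hC⟩ := hac.const_of_ae_hasDerivAt_zero (by
    filter_upwards [hd, hf.ae_hasDerivAt_integral] with x h1 h2 h3
    have := (h1 (by rwa [Set.uIcc_of_le zero_le_one] at h3)).fun_sub (h2 h3 0 (by simp))
    simpa using this)
  intro x hx
  have e1 := hC x (by rwa [Set.uIcc_of_le zero_le_one])
  have e2 := hC 0 (by simp)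
  simp only [intervalIntegral.integral_same, sub_zero] at e2
  rw [e2, ← e1]; ring

lemma IsPrim.mul (hF : IsPrim f F) (hG : IsPrim g G) :
    IsPrim (fun t => f t * G t + F t * g t) (fun t => F t * G t) := by
  have c1 : ContinuousOn F (Set.uIcc 0 1) := hF.ac.continuousOn
  have c2 : ContinuousOn G (Set.uIcc 0 1) := hG.ac.continuousOn
  refine isPrim_of_ac ((hF.1.mul_continuousOn c2).add (hG.1.continuousOn_mul c1)) ?_ ?_
  · exact hF.ac.fun_smul hG.ac
  · filter_upwards [hF.ae_deriv, hG.ae_deriv] with x h1 h2 h3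
    exact (h1 h3).mul (h2 h3)

lemma IsPrim.add (hF : IsPrim f F) (hG : IsPrim g G) :
    IsPrim (fun t => f t + g t) (fun t => F t + G t) := by
  refine isPrim_of_ac (hF.1.add hG.1) (hF.ac.fun_add hG.ac) ?_
  filter_upwards [hF.ae_deriv, hG.ae_deriv] with x h1 h2 h3
  exact (h1 h3).add (h2 h3)

lemma IsPrim.sub (hF : IsPrim f F) (hG : IsPrim g G) :
    IsPrim (fun t => f t - g t) (fun t => F t - G t) := by
  refine isPrim_of_ac (hF.1.sub hG.1) (hF.ac.fun_sub hG.ac) ?_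
  filter_upwards [hF.ae_deriv, hG.ae_deriv] with x h1 h2 h3
  exact (h1 h3).sub (h2 h3)

lemma isPrim_of_hasDerivAt (hd : ∀ x, HasDerivAt F (f x) x) (hf : Continuous f) : IsPrim f F := by
  refine ⟨hf.intervalIntegrable _ _, fun x hx => ?_⟩
  rw [intervalIntegral.integral_eq_sub_of_hasDerivAt (fun x _ => hd x) (hf.intervalIntegrable _ _)]
  ring

lemma IsPrim.const_mul (hF : IsPrim f F) (c : 𝕜) :
    IsPrim (fun t => c * f t) (fun t => c * F t) := by
  refine ⟨hF.1.const_mul c, fun x hx => ?_⟩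
  show c * F x = c * F 0 + ∫ t in (0:ℝ)..x, c * f t
  rw [hF.2 x hx, intervalIntegral.integral_const_mul]; ring

lemma IsPrim.congr (hF : IsPrim f F) (h1 : ∀ x ∈ Set.Icc (0:ℝ) 1, f x = g x)
    (h2 : ∀ x ∈ Set.Icc (0:ℝ) 1, F x = G x) : IsPrim g G := by
  refine ⟨hF.1.congr ?_, fun x hx => ?_⟩
  · intro x hx
    rw [Set.uIoc_of_le zero_le_one] at hx
    exact h1 x ⟨hx.1.le, hx.2⟩
  · rw [← h2 x hx, ← h2 0 (by simp), hF.2 x hx]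
    congr 1
    apply intervalIntegral.integral_congr
    intro y hy
    rw [Set.uIcc_of_le hx.1] at hy
    exact h1 y ⟨hy.1, hy.2.trans hx.2⟩

lemma IsPrim.ae_unique (hF : IsPrim f F) (hG : IsPrim g G)
    (h : ∀ x ∈ Set.Icc (0:ℝ) 1, F x = G x) : ∀ᵐ x : ℝ, x ∈ Set.Icc (0:ℝ) 1 → f x = g x := by
  filter_upwards [hF.ae_deriv, hG.ae_deriv, ae_interior] with x h1 h2 h3 h4
  refine (h1 h4).unique ((h2 h4).congr_of_eventuallyEq ?_)
  filter_upwards [Ioo_mem_nhds (h3 h4).1 (h3 h4).2] with y hy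
  exact h y ⟨hy.1.le, hy.2.le⟩

lemma IsPrim.unique (hF : IsPrim f F) (hG : IsPrim g G)
    (h : ∀ x ∈ Set.Icc (0:ℝ) 1, F x = G x) (cf : ContinuousOn f (Set.Icc 0 1))
    (cg : ContinuousOn g (Set.Icc 0 1)) : ∀ x ∈ Set.Icc (0:ℝ) 1, f x = g x := by
  have := hF.ae_unique hG h
  rw [← ae_restrict_iff' measurableSet_Icc] at this
  exact Measure.eqOn_Icc_of_ae_eq volume zero_ne_one this cf cg

end prim


section volterra

/-- continuous complex functions on `[0,1]` -/
abbrev CI := C(Set.Icc (0:ℝ) 1, ℂ)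

/-- extension of a continuous function on `[0,1]` to `ℝ`. -/
def extI (f : CI) : ℝ → ℂ := Set.IccExtend zero_le_one f

lemma extI_cont (f : CI) : Continuous (extI f) := f.continuous.Icc_extend'

lemma extI_apply (f : CI) {x : ℝ} (hx : x ∈ Set.Icc (0:ℝ) 1) : extI f x = f ⟨x, hx⟩ :=
  Set.IccExtend_of_mem _ _ hx

lemma extI_norm_le (f : CI) (x : ℝ) : ‖extI f x‖ ≤ ‖f‖ := f.norm_coe_le_norm _

lemma intble_mul_ext {p : ℝ → ℂ} (hp : IntervalIntegrable p volume 0 1) (f : CI) :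
    IntervalIntegrable (fun t => p t * extI f t) volume 0 1 :=
  hp.mul_continuousOn (extI_cont f).continuousOn

/-- Volterra operator `f ↦ ∫_0^x p f`. -/
def Vol (p : ℝ → ℂ) (hp : IntervalIntegrable p volume 0 1) : CI →L[ℂ] CI :=
  LinearMap.mkContinuous
    { toFun := fun f => ⟨fun x => ∫ t in (0:ℝ)..x, p t * extI f t, by
        have := (ac_integral (intble_mul_ext hp f)).continuousOn
        rw [Set.uIcc_of_le zero_le_one] at this
        exact this.domRestrict⟩
      map_add' := by
        intro f g
        ext x
        show ∫ t in (0:ℝ)..x, p t * extI (f + g) t = (∫ t in (0:ℝ)..x, p t * extI f t) + 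
          ∫ t in (0:ℝ)..x, p t * extI g t
        rw [← intervalIntegral.integral_add (intervalIntegrable_sub01 (intble_mul_ext hp f) x.2)
          (intervalIntegrable_sub01 (intble_mul_ext hp g) x.2)]
        congr 1
        ext t
        rw [← mul_add]
        rfl
      map_smul' := by
        intro c f
        ext x
        show ∫ t in (0:ℝ)..x, p t * extI (c • f) t = c * ∫ t in (0:ℝ)..x, p t * extI f t
        rw [← intervalIntegral.integral_const_mul]
        congr 1
        ext t
        rw [mul_left_comm]
        rfl }
    (∫ t in (0:ℝ)..1, ‖p t‖) (by
      intro f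
      rw [ContinuousMap.norm_le _ (mul_nonneg (intervalIntegral.integral_nonneg zero_le_one
        (fun _ _ => norm_nonneg _)) (norm_nonneg _))]
      intro x
      show ‖∫ t in (0:ℝ)..x, p t * extI f t‖ ≤ _
      calc ‖∫ t in (0:ℝ)..x, p t * extI f t‖ ≤ ∫ t in (0:ℝ)..x, ‖p t‖ * ‖f‖ := by
            apply intervalIntegral.norm_integral_le_of_norm_le x.2.1
            · refine Filter.Eventually.of_forall fun t _ => ?_
              rw [norm_mul]
              gcongr
              exact extI_norm_le f t
            · exact (intervalIntegrable_sub01 hp x.2).norm.mul_const _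
        _ = (∫ t in (0:ℝ)..x, ‖p t‖) * ‖f‖ := by rw [intervalIntegral.integral_mul_const]
        _ ≤ _ := by
            gcongr
            apply intervalIntegral.integral_mono_interval le_rfl x.2.1 x.2.2
            · exact Filter.Eventually.of_forall fun t => norm_nonneg _
            · exact hp.norm)

lemma Vol_apply (p : ℝ → ℂ) (hp : IntervalIntegrable p volume 0 1) (f : CI) (x : Set.Icc (0:ℝ) 1) :
    Vol p hp f x = ∫ t in (0:ℝ)..x, p t * extI f t := rfl

lemma Vol_isPrim (p : ℝ → ℂ) (hp : IntervalIntegrable p volume 0 1) (f : CI) :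
    IsPrim (fun t => p t * extI f t) (extI (Vol p hp f)) := by
  refine ⟨intble_mul_ext hp f, fun x hx => ?_⟩
  rw [extI_apply _ hx, extI_apply _ (by simp : (0:ℝ) ∈ Set.Icc (0:ℝ) 1), Vol_apply, Vol_apply]
  simp

lemma one_int : IntervalIntegrable (fun _ : ℝ => (1:ℂ)) volume 0 1 := intervalIntegrable_const

/-- `∫_0^x r R^n = R^{n+1}/(n+1)`. -/
lemma prim_pow {r R : ℝ → ℝ} (h : IsPrim r R) (n : ℕ) :
    IsPrim (fun t => r t * R t ^ n) (fun t => R t ^ (n+1) / (n+1)) := by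
  have H : IsPrim (fun t => (n+1) * (r t * R t ^ n)) (fun t => R t ^ (n+1)) := by
    induction n with
    | zero => simpa using h
    | succ n ih =>
      refine (ih.mul h).congr ?_ ?_
      · intro x _; push_cast; ring
      · intro x _; ring
  refine (H.const_mul (1 / ((n:ℝ)+1))).congr ?_ ?_
  · intro x _
    have : (n:ℝ) + 1 ≠ 0 := by positivity
    field_simp
  · intro x _; ring

lemma Vol_iter_bound (p : ℝ → ℂ) (hp : IntervalIntegrable p volume 0 1) (f : CI) (K : ℝ) (n : ℕ)
    (hf : ∀ x : Set.Icc (0:ℝ) 1, ‖f x‖ ≤ K * (∫ t in (0:ℝ)..x, ‖p t‖) ^ n / n.factorial)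
    (hK : 0 ≤ K) (x : Set.Icc (0:ℝ) 1) :
    ‖Vol (fun _ => 1) one_int (Vol p hp f) x‖ ≤
      K * (∫ t in (0:ℝ)..x, ‖p t‖) ^ (n+1) / (n+1).factorial := by
  set R : ℝ → ℝ := fun x => ∫ t in (0:ℝ)..x, ‖p t‖ with hR
  have hRp : IsPrim (fun t => ‖p t‖) R := ⟨hp.norm, fun x _ => by simp [hR]⟩
  have hR0 : R 0 = 0 := by simp [hR]
  have hRm : ∀ x ∈ Set.Icc (0:ℝ) 1, ∀ y ∈ Set.Icc (0:ℝ) 1, x ≤ y → R x ≤ R y := by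
    intro x hx y hy hxy
    apply intervalIntegral.integral_mono_interval le_rfl hx.1 hxy
    · exact Filter.Eventually.of_forall fun t => norm_nonneg _
    · exact (intervalIntegrable_sub01 hp hy).norm
  have hRn : ∀ x ∈ Set.Icc (0:ℝ) 1, 0 ≤ R x := by
    intro x hx
    have := hRm 0 (by simp) x hx hx.1
    rwa [hR0] at this
  have h1 : ∀ y : Set.Icc (0:ℝ) 1, ‖Vol p hp f y‖ ≤ K * R y ^ (n+1) / (n+1).factorial := by
    intro y
    rw [Vol_apply]
    have hpp := prim_pow hRp n
    calc ‖∫ t in (0:ℝ)..y, p t * extI f t‖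
        ≤ ∫ t in (0:ℝ)..y, (K / n.factorial) * (‖p t‖ * R t ^ n) := by
          apply intervalIntegral.norm_integral_le_of_norm_le y.2.1
          · refine Filter.Eventually.of_forall fun t ht => ?_
            have ht' : t ∈ Set.Icc (0:ℝ) 1 := ⟨ht.1.le, ht.2.trans y.2.2⟩
            rw [norm_mul, extI_apply _ ht']
            calc ‖p t‖ * ‖f ⟨t, ht'⟩‖ ≤ ‖p t‖ * (K * R t ^ n / n.factorial) := by
                  gcongr
                  exact hf ⟨t, ht'⟩
              _ = _ := by ring
          · exact (intervalIntegrable_sub01 hpp.1 y.2).const_mul _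
      _ = (K / n.factorial) * (R y ^ (n+1) / (n+1)) := by
          rw [intervalIntegral.integral_const_mul]
          have := hpp.2 y y.2
          simp only [hR0] at this
          rw [this]
          simp
      _ = _ := by
          rw [Nat.factorial_succ]; push_cast
          field_simp
  rw [Vol_apply]
  calc ‖∫ t in (0:ℝ)..x, 1 * extI (Vol p hp f) t‖
      ≤ (K * R x ^ (n+1) / (n+1).factorial) * |(x:ℝ) - 0| := by
        apply intervalIntegral.norm_integral_le_of_norm_le_const
        intro t ht
        rw [Set.uIoc_of_le x.2.1] at ht
        have ht' : t ∈ Set.Icc (0:ℝ) 1 := ⟨ht.1.le, ht.2.trans x.2.2⟩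
        rw [one_mul, extI_apply _ ht']
        refine (h1 ⟨t, ht'⟩).trans ?_
        have := hRm t ht' x x.2 ht.2
        have := hRn t ht'
        gcongr
    _ ≤ (K * R x ^ (n+1) / (n+1).factorial) * 1 := by
        have := hRn x x.2
        gcongr
        rw [sub_zero, abs_of_nonneg x.2.1]
        exact x.2.2
    _ = _ := mul_one _

lemma isUnit_one_sub_vol (p : ℝ → ℂ) (hp : IntervalIntegrable p volume 0 1) :
    IsUnit (1 - (Vol (fun _ => 1) one_int).comp (Vol p hp)) := by
  set T := (Vol (fun _ => 1) one_int).comp (Vol p hp) with hT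
  set A := ∫ t in (0:ℝ)..1, ‖p t‖ with hA
  have hb : ∀ (n : ℕ) (f : CI) (x : Set.Icc (0:ℝ) 1),
      ‖(T ^ n) f x‖ ≤ ‖f‖ * (∫ t in (0:ℝ)..x, ‖p t‖) ^ n / n.factorial := by
    intro n f
    induction n with
    | zero => intro x; simpa using f.norm_coe_le_norm x
    | succ n ih =>
      intro x
      rw [pow_succ']
      exact Vol_iter_bound p hp ((T ^ n) f) ‖f‖ n ih (norm_nonneg _) x
  have hR : ∀ x : Set.Icc (0:ℝ) 1, 0 ≤ ∫ t in (0:ℝ)..x, ‖p t‖ := fun x =>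
    intervalIntegral.integral_nonneg x.2.1 (fun _ _ => norm_nonneg _)
  have hA0 : 0 ≤ A := hR ⟨1, by simp⟩
  have hn : ∀ n : ℕ, ‖T ^ n‖ ≤ A ^ n / n.factorial := by
    intro n
    refine ContinuousLinearMap.opNorm_le_bound _ (by positivity) fun f => ?_
    rw [ContinuousMap.norm_le _ (by positivity)]
    intro x
    refine (hb n f x).trans ?_
    have : (∫ t in (0:ℝ)..x, ‖p t‖) ≤ A := by
      apply intervalIntegral.integral_mono_interval le_rfl x.2.1 x.2.2
      · exact Filter.Eventually.of_forall fun t => norm_nonneg _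
      · exact hp.norm
    have h0 := hR x
    calc ‖f‖ * (∫ t in (0:ℝ)..x, ‖p t‖) ^ n / n.factorial ≤ ‖f‖ * A ^ n / n.factorial := by gcongr
      _ = _ := by ring
  have hlim := FloorSemiring.tendsto_pow_div_factorial_atTop A
  obtain ⟨n, hn1⟩ := (hlim.eventually (gt_mem_nhds (zero_lt_one))).exists
  have hu : IsUnit (1 - T ^ n) :=
    isUnit_one_sub_of_norm_lt_one (R := CI →L[ℂ] CI) (x := T ^ n) ((hn n).trans_lt hn1)
  have e1 : (1 - T) * (∑ i ∈ Finset.range n, T ^ i) = 1 - T ^ n := mul_neg_geom_sum T n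
  have e2 : (∑ i ∈ Finset.range n, T ^ i) * (1 - T) = 1 - T ^ n := geom_sum_mul_neg T n
  rw [← e1] at hu
  exact ((show Commute (1 - T) (∑ i ∈ Finset.range n, T ^ i) from e1.trans e2.symm).isUnit_mul_iff.1 hu).1

end volterra


section sols

/-- complex solutions of `-u'' + q u = lam u`, `v = u'`. -/
def CSol (q : ℝ → ℝ) (lam : ℂ) (u v : ℝ → ℂ) : Prop :=
  IsPrim v u ∧ IsPrim (fun t => ((q t : ℂ) - lam) * u t) v

lemma pot_int {q : ℝ → ℝ} (hq : IntervalIntegrable (fun t => (q t : ℂ)) volume 0 1) (lam : ℂ) :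
    IntervalIntegrable (fun t => (q t : ℂ) - lam) volume 0 1 :=
  hq.sub intervalIntegrable_const

lemma Vol_sub_const {q : ℝ → ℝ} (hq : IntervalIntegrable (fun t => (q t : ℂ)) volume 0 1) (lam : ℂ) :
    Vol _ (pot_int hq lam) = Vol _ hq - lam • Vol _ one_int := by
  ext f x
  show ∫ t in (0:ℝ)..x, ((q t : ℂ) - lam) * extI f t = (∫ t in (0:ℝ)..x, (q t : ℂ) * extI f t) -
    lam * ∫ t in (0:ℝ)..x, 1 * extI f t
  rw [← intervalIntegral.integral_const_mul, ← intervalIntegral.integral_sub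
    (intervalIntegrable_sub01 (intble_mul_ext hq f) x.2)
    ((intervalIntegrable_sub01 (intble_mul_ext one_int f) x.2).const_mul _)]
  congr 1
  ext t
  ring

lemma extI_sub (f g : CI) (x : ℝ) : extI (f - g) x = extI f x - extI g x := rfl
lemma extI_add (f g : CI) (x : ℝ) : extI (f + g) x = extI f x + extI g x := rfl

lemma CSol.zero_of_data {q : ℝ → ℝ} (hq : IntervalIntegrable (fun t => (q t : ℂ)) volume 0 1)
    {lam : ℂ} {u v : ℝ → ℂ} (h : CSol q lam u v) (hu : u 0 = 0) (hv : v 0 = 0) :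
    ∀ x ∈ Set.Icc (0:ℝ) 1, u x = 0 ∧ v x = 0 := by
  obtain ⟨h1, h2⟩ := h
  have cu := h1.continuousOn
  let U : CI := ⟨fun x => u x, cu.domRestrict⟩
  have hUu : ∀ x ∈ Set.Icc (0:ℝ) 1, extI U x = u x := fun x hx => extI_apply U hx
  have hV : ∀ x ∈ Set.Icc (0:ℝ) 1, extI (Vol _ (pot_int hq lam) U) x = v x := by
    intro x hx
    rw [extI_apply _ hx, Vol_apply, h2.2 x hx, hv, zero_add]
    apply intervalIntegral.integral_congr
    intro y hy
    rw [Set.uIcc_of_le hx.1] at hy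
    show _ * extI U y = _
    rw [hUu y ⟨hy.1, hy.2.trans hx.2⟩]
  have hT : ((Vol (fun _ => 1) one_int).comp (Vol _ (pot_int hq lam))) U = U := by
    ext x
    show ∫ t in (0:ℝ)..x, 1 * extI (Vol _ (pot_int hq lam) U) t = u x
    rw [h1.2 x x.2, hu, zero_add]
    apply intervalIntegral.integral_congr
    intro y hy
    rw [Set.uIcc_of_le x.2.1] at hy
    show 1 * extI _ y = _
    rw [hV y ⟨hy.1, hy.2.trans x.2.2⟩, one_mul]
  obtain ⟨W, hW⟩ := isUnit_one_sub_vol _ (pot_int hq lam)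
  have hz : (W : CI →L[ℂ] CI) U = 0 := by
    rw [hW]
    exact sub_eq_zero.2 hT.symm
  have hU0 : U = 0 := by
    have e : ((↑W⁻¹ : CI →L[ℂ] CI) * (W : CI →L[ℂ] CI)) U = U := by
      rw [Units.inv_mul]; rfl
    rw [← e]
    show (↑W⁻¹ : CI →L[ℂ] CI) ((W : CI →L[ℂ] CI) U) = 0
    rw [hz, map_zero]
  intro x hx
  constructor
  · rw [← hUu x hx, hU0]; rfl
  · rw [← hV x hx, hU0, map_zero]; rfl

lemma CSol.lin {q : ℝ → ℝ} {lam : ℂ} {u v u2 v2 : ℝ → ℂ} (h : CSol q lam u v)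
    (h2 : CSol q lam u2 v2) (c : ℂ) :
    CSol q lam (fun t => u t - c * u2 t) (fun t => v t - c * v2 t) := by
  refine ⟨h.1.sub (h2.1.const_mul c), ?_⟩
  refine (h.2.sub (h2.2.const_mul c)).congr ?_ (fun _ _ => rfl)
  intro x _
  ring

/-- uniqueness up to a factor -/
lemma CSol.eq_mul {q : ℝ → ℝ} (hq : IntervalIntegrable (fun t => (q t : ℂ)) volume 0 1)
    {lam : ℂ} {u v u2 v2 : ℝ → ℂ} (h : CSol q lam u v) (h2 : CSol q lam u2 v2) (c : ℂ)
    (e1 : u 0 = c * u2 0) (e2 : v 0 = c * v2 0) :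
    ∀ x ∈ Set.Icc (0:ℝ) 1, u x = c * u2 x ∧ v x = c * v2 x := by
  intro x hx
  have := (h.lin h2 c).zero_of_data hq (by simp [e1]) (by simp [e2]) x hx
  exact ⟨sub_eq_zero.1 this.1, sub_eq_zero.1 this.2⟩

lemma diff_resolvent {E : Type*} [NormedAddCommGroup E] [NormedSpace ℂ E] [CompleteSpace E]
    (A B : E →L[ℂ] E) (f0 : E) (h : ∀ lam : ℂ, IsUnit (1 - (A - lam • B))) :
    Differentiable ℂ (fun lam : ℂ => Ring.inverse (1 - (A - lam • B)) f0) := by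
  intro lam
  have hT : Differentiable ℂ (fun lam : ℂ => 1 - (A - lam • B)) := by fun_prop
  have h1 : DifferentiableAt ℂ (fun lam => Ring.inverse (1 - (A - lam • B))) lam :=
    DifferentiableAt.comp (g := Ring.inverse) (f := fun lam : ℂ => 1 - (A - lam • B)) lam
      (differentiableAt_inverse (𝕜 := ℂ) (R := E →L[ℂ] E) (h lam)) (hT lam)
  exact h1.clm_apply (differentiableAt_const f0)

theorem exists_CSol {q : ℝ → ℝ} (hq : IntervalIntegrable (fun t => (q t : ℂ)) volume 0 1) (a b : ℂ) :
    ∃ u v : ℂ → ℝ → ℂ, (∀ lam, CSol q lam (u lam) (v lam)) ∧ (∀ lam, u lam 0 = a) ∧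
      (∀ lam, v lam 0 = b) ∧ (∀ x, Differentiable ℂ (fun lam => u lam x)) ∧
      (∀ x, Differentiable ℂ (fun lam => v lam x)) ∧
      (∀ lam₀, ∀ ε > 0, ∀ᶠ lam in nhds lam₀, ∀ x, ‖u lam x - u lam₀ x‖ ≤ ε) := by
  let V1 := Vol _ one_int
  let f0 : CI := ⟨fun x => a + b * (x:ℝ), by fun_prop⟩
  let T : ℂ → (CI →L[ℂ] CI) := fun lam => V1.comp (Vol _ hq - lam • V1)
  have hT : ∀ lam, T lam = V1.comp (Vol _ (pot_int hq lam)) := fun lam => by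
    rw [Vol_sub_const]
  have hunit : ∀ lam, IsUnit (1 - T lam) := fun lam => by
    rw [hT]; exact isUnit_one_sub_vol _ _
  let U : ℂ → CI := fun lam => Ring.inverse (1 - T lam) f0
  have hTe : T = fun lam => V1.comp (Vol _ hq) - lam • (V1.comp V1) := by
    ext lam f x
    simp [T]
  have hUd : Differentiable ℂ U := by
    have h := hunit
    simp only [U]
    rw [hTe] at h ⊢
    exact diff_resolvent _ _ f0 h
  have hUeq : ∀ lam, U lam = f0 + V1 (Vol _ (pot_int hq lam) (U lam)) := by
    intro lam
    have e : ((1 - T lam) * Ring.inverse (1 - T lam)) f0 = f0 := by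
      rw [Ring.mul_inverse_cancel _ (hunit lam)]; rfl
    have e2 : U lam - T lam (U lam) = f0 := e
    rw [hT] at e2
    exact (sub_eq_iff_eq_add.1 e2)
  have hev : ∀ x, ∀ f : ℂ → CI, Differentiable ℂ f → Differentiable ℂ (fun lam => extI (f lam) x) := by
    intro x f hf
    exact (ContinuousMap.evalCLM ℂ (Set.projIcc 0 1 zero_le_one x)).differentiable.comp hf
  have h0 : (0:ℝ) ∈ Set.Icc (0:ℝ) 1 := by simp
  refine ⟨fun lam => extI (U lam), fun lam x => b + extI (Vol _ (pot_int hq lam) (U lam)) x,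
    fun lam => ⟨?_, ?_⟩, fun lam => ?_, fun lam => ?_, fun x => hev x U hUd, fun x => ?_, ?_⟩
  · have p1 : IsPrim (fun _ : ℝ => b) (fun x : ℝ => a + b * (x:ℂ)) := by
      apply isPrim_of_hasDerivAt
      · intro x
        have := ((Complex.ofRealCLM.hasDerivAt (x := x)).const_mul b).const_add a
        simpa using this
      · fun_prop
    refine (p1.add (Vol_isPrim _ one_int (Vol _ (pot_int hq lam) (U lam)))).congr ?_ ?_
    · intro x _; simp
    · intro x hx
      show _ = extI (U lam) x
      conv_rhs => rw [hUeq lam]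
      rw [extI_add, extI_apply f0 hx]
      rfl
  · refine ((isPrim_of_hasDerivAt (f := fun _ => (0:ℂ)) (F := fun _ => b)
      (fun x => hasDerivAt_const x b) continuous_const).add
      (Vol_isPrim _ (pot_int hq lam) (U lam))).congr ?_ (fun _ _ => rfl)
    intro x _; simp
  · show extI (U lam) 0 = a
    rw [hUeq lam, extI_add, extI_apply f0 h0, extI_apply _ h0, Vol_apply]
    simp [f0]
  · show b + extI _ 0 = b
    rw [extI_apply _ h0, Vol_apply]
    simp
  · refine (differentiable_const _).add (hev x (fun lam => Vol _ (pot_int hq lam) (U lam)) ?_)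
    have : (fun lam => Vol _ (pot_int hq lam) (U lam)) =
        fun lam => Vol _ hq (U lam) - lam • (V1 (U lam)) := by
      ext1 lam
      rw [Vol_sub_const]; rfl
    rw [this]
    exact ((Vol _ hq).differentiable.comp hUd).sub
      (differentiable_id.smul (V1.differentiable.comp hUd))
  · intro lam₀ ε hε
    have := Metric.continuous_iff.1 hUd.continuous lam₀ ε hε
    have := (Metric.tendsto_nhds.1 (hUd.continuous.tendsto lam₀)) ε hε
    filter_upwards [this] with lam hlam x
    rw [← extI_sub]
    refine (extI_norm_le _ x).trans ?_
    rw [← dist_eq_norm]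
    exact hlam.le

end sols


section asym

lemma norm_cos_le_exp (w : ℂ) : ‖Complex.cos w‖ ≤ Real.exp |w.im| := by
  rw [Complex.cos]
  have h1 : ‖Complex.exp (w * I)‖ ≤ Real.exp |w.im| := by
    rw [Complex.norm_exp]; apply Real.exp_le_exp.2; simpa using neg_le_abs w.im
  have h2 : ‖Complex.exp (-w * I)‖ ≤ Real.exp |w.im| := by
    rw [Complex.norm_exp]; apply Real.exp_le_exp.2; simpa using le_abs_self w.im
  rw [norm_div]
  have := norm_add_le (Complex.exp (w * I)) (Complex.exp (-w * I))
  simp only [Complex.norm_ofNat]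
  linarith

lemma norm_sin_le_exp (w : ℂ) : ‖Complex.sin w‖ ≤ Real.exp |w.im| := by
  rw [Complex.sin]
  have h1 : ‖Complex.exp (w * I)‖ ≤ Real.exp |w.im| := by
    rw [Complex.norm_exp]; apply Real.exp_le_exp.2; simpa using neg_le_abs w.im
  have h2 : ‖Complex.exp (-w * I)‖ ≤ Real.exp |w.im| := by
    rw [Complex.norm_exp]; apply Real.exp_le_exp.2; simpa using le_abs_self w.im
  rw [norm_div, norm_mul, Complex.norm_I]
  have := norm_sub_le (Complex.exp (-w * I)) (Complex.exp (w * I))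
  simp only [Complex.norm_ofNat]
  linarith

lemma hasDerivAt_lin (z : ℂ) (x t : ℝ) :
    HasDerivAt (fun t : ℝ => z * ((x:ℂ) - (t:ℂ))) (-z) t := by
  have := ((Complex.ofRealCLM.hasDerivAt (x := t)).const_sub (x:ℂ)).const_mul z
  simpa using this

lemma prim_cos (z : ℂ) (x : ℝ) : IsPrim (fun t : ℝ => z * Complex.sin (z * ((x:ℂ) - (t:ℂ))))
    (fun t : ℝ => Complex.cos (z * ((x:ℂ) - (t:ℂ)))) := by
  apply isPrim_of_hasDerivAt
  · intro t
    have := HasDerivAt.scomp t (Complex.hasDerivAt_cos (z * ((x:ℂ) - (t:ℂ)))) (hasDerivAt_lin z x t)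
    have e : z * Complex.sin (z * ((x:ℂ) - (t:ℂ))) = -z • -Complex.sin (z * ((x:ℂ) - (t:ℂ))) := by
      rw [smul_eq_mul]; ring
    rw [e]
    exact this
  · fun_prop

lemma prim_sin (z : ℂ) (x : ℝ) : IsPrim (fun t : ℝ => -z * Complex.cos (z * ((x:ℂ) - (t:ℂ))))
    (fun t : ℝ => Complex.sin (z * ((x:ℂ) - (t:ℂ)))) := by
  apply isPrim_of_hasDerivAt
  · intro t
    have := HasDerivAt.scomp t (Complex.hasDerivAt_sin (z * ((x:ℂ) - (t:ℂ)))) (hasDerivAt_lin z x t)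
    exact this
  · fun_prop

variable {q : ℝ → ℝ} {z : ℂ} {u v : ℝ → ℂ}

lemma var_const1 (hz : z ≠ 0) (h : CSol q (z ^ 2) u v) {x : ℝ} (hx : x ∈ Set.Icc (0:ℝ) 1) :
    u x = Complex.cos (z * x) * u 0 + Complex.sin (z * x) / z * v 0 +
      ∫ t in (0:ℝ)..x, (Complex.sin (z * ((x:ℂ) - t)) / z) * ((q t : ℂ) * u t) := by
  have p := ((((prim_sin z x).const_mul (1 / z)).mul h.2).add ((prim_cos z x).mul h.1))
  have p2 := p.congr (g := fun t : ℝ => (Complex.sin (z * ((x:ℂ) - t)) / z) * ((q t : ℂ) * u t))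
    (by intro t _; field_simp; ring) (fun _ _ => rfl)
  have := p2.2 x hx
  simp only [sub_self, mul_zero, Complex.sin_zero, Complex.cos_zero, zero_mul, zero_add, one_mul,
    Complex.ofReal_zero, sub_zero] at this
  rw [this]
  ring

lemma var_const2 (h : CSol q (z ^ 2) u v) {x : ℝ} (hx : x ∈ Set.Icc (0:ℝ) 1) :
    v x = Complex.cos (z * x) * v 0 - z * Complex.sin (z * x) * u 0 +
      ∫ t in (0:ℝ)..x, Complex.cos (z * ((x:ℂ) - t)) * ((q t : ℂ) * u t) := by
  have p := ((prim_cos z x).mul h.2).sub (((prim_sin z x).const_mul z).mul h.1)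
  have p2 := p.congr (g := fun t : ℝ => Complex.cos (z * ((x:ℂ) - t)) * ((q t : ℂ) * u t))
    (by intro t _; ring) (fun _ _ => rfl)
  have := p2.2 x hx
  simp only [sub_self, mul_zero, Complex.sin_zero, Complex.cos_zero, zero_mul, one_mul,
    Complex.ofReal_zero, sub_zero] at this
  rw [this]

lemma kernel_bound (hq : IntervalIntegrable (fun t => (q t : ℂ)) volume 0 1) {x : ℝ}
    (hx : x ∈ Set.Icc (0:ℝ) 1) {M c s : ℝ} (hM : 0 ≤ M) (hc : 0 ≤ c) {k : ℝ → ℂ}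
    (hu : ∀ t ∈ Set.Icc (0:ℝ) 1, ‖u t‖ ≤ M * Real.exp (s * t))
    (hk : ∀ t ∈ Set.Icc (0:ℝ) x, ‖k t‖ ≤ c * Real.exp (s * (x - t))) :
    ‖∫ t in (0:ℝ)..x, k t * ((q t : ℂ) * u t)‖ ≤
      c * M * (∫ t in (0:ℝ)..1, ‖(q t : ℂ)‖) * Real.exp (s * x) := by
  calc ‖∫ t in (0:ℝ)..x, k t * ((q t : ℂ) * u t)‖
      ≤ ∫ t in (0:ℝ)..x, (c * M * Real.exp (s * x)) * ‖(q t : ℂ)‖ := by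
        apply intervalIntegral.norm_integral_le_of_norm_le hx.1
        · refine Filter.Eventually.of_forall fun t ht => ?_
          have h1 := hk t ⟨ht.1.le, ht.2⟩
          have h2 := hu t ⟨ht.1.le, ht.2.trans hx.2⟩
          rw [norm_mul, norm_mul]
          calc ‖k t‖ * (‖(q t : ℂ)‖ * ‖u t‖)
              ≤ (c * Real.exp (s * (x - t))) * (‖(q t : ℂ)‖ * (M * Real.exp (s * t))) := by gcongr
            _ = (c * M * (Real.exp (s * (x - t)) * Real.exp (s * t))) * ‖(q t : ℂ)‖ := by ring
            _ = _ := by rw [← Real.exp_add]; ring_nf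
        · exact (intervalIntegrable_sub01 hq hx).norm.const_mul _
    _ = (c * M * Real.exp (s * x)) * ∫ t in (0:ℝ)..x, ‖(q t : ℂ)‖ := by
        rw [intervalIntegral.integral_const_mul]
    _ ≤ (c * M * Real.exp (s * x)) * ∫ t in (0:ℝ)..1, ‖(q t : ℂ)‖ := by
        gcongr
        apply intervalIntegral.integral_mono_interval le_rfl hx.1 hx.2
        · exact Filter.Eventually.of_forall fun t => norm_nonneg _
        · exact hq.norm
    _ = _ := by ring

lemma im_lin (z : ℂ) {x t : ℝ} (h : t ≤ x) : |(z * ((x:ℂ) - (t:ℂ))).im| = |z.im| * (x - t) := by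
  rw [← Complex.ofReal_sub, Complex.im_mul_ofReal, abs_mul, abs_of_nonneg (sub_nonneg.2 h)]

lemma im_lin0 (z : ℂ) {x : ℝ} (h : 0 ≤ x) : |(z * (x:ℂ)).im| = |z.im| * x := by
  rw [Complex.im_mul_ofReal, abs_mul, abs_of_nonneg h]

lemma sol_bound (hq : IntervalIntegrable (fun t => (q t : ℂ)) volume 0 1)
    (h : CSol q (z ^ 2) u v) (hz1 : 1 ≤ ‖z‖) (hz2 : 2 * (∫ t in (0:ℝ)..1, ‖(q t : ℂ)‖) ≤ ‖z‖)
    {x : ℝ} (hx : x ∈ Set.Icc (0:ℝ) 1) :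
    ‖u x‖ ≤ 2 * (‖u 0‖ + ‖v 0‖ / ‖z‖) * Real.exp (|z.im| * x) := by
  set Q := ∫ t in (0:ℝ)..1, ‖(q t : ℂ)‖ with hQ
  have hz0 : 0 < ‖z‖ := by linarith
  have hz : z ≠ 0 := norm_pos_iff.1 hz0
  have cont : ContinuousOn (fun x => ‖u x‖ * Real.exp (-(|z.im| * x))) (Set.Icc 0 1) :=
    h.1.continuousOn.norm.mul (by fun_prop)
  obtain ⟨y, hy, hmax⟩ := isCompact_Icc.exists_isMaxOn ⟨0, by simp⟩ cont
  set M := ‖u y‖ * Real.exp (-(|z.im| * y)) with hM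
  have hM0 : 0 ≤ M := by positivity
  have hMb : ∀ t ∈ Set.Icc (0:ℝ) 1, ‖u t‖ ≤ M * Real.exp (|z.im| * t) := by
    intro t ht
    have := hmax ht
    simp only [Set.mem_ofPred_eq] at this
    calc ‖u t‖ = ‖u t‖ * Real.exp (-(|z.im| * t)) * Real.exp (|z.im| * t) := by
          rw [mul_assoc, ← Real.exp_add]; simp
      _ ≤ _ := by gcongr
  have key : ∀ x ∈ Set.Icc (0:ℝ) 1,
      ‖u x‖ ≤ (‖u 0‖ + ‖v 0‖ / ‖z‖ + 1 / ‖z‖ * M * Q) * Real.exp (|z.im| * x) := by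
    intro x hx
    have hv := var_const1 hz h hx
    have kb := kernel_bound (u := u) (k := fun t : ℝ => Complex.sin (z * ((x:ℂ) - t)) / z) hq hx hM0
      (c := 1 / ‖z‖) (s := |z.im|) (by positivity) hMb (by
        intro t ht
        rw [norm_div, div_mul_eq_mul_div, one_mul]
        gcongr
        have := norm_sin_le_exp (z * ((x:ℂ) - t))
        rwa [im_lin z ht.2] at this)
    have e1 := norm_cos_le_exp (z * x)
    have e2 := norm_sin_le_exp (z * x)
    rw [im_lin0 z hx.1] at e1 e2
    rw [hv]
    calc _ ≤ ‖Complex.cos (z * x) * u 0‖ + ‖Complex.sin (z * x) / z * v 0‖ + _ := norm_add₃_le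
      _ ≤ Real.exp (|z.im| * x) * ‖u 0‖ + Real.exp (|z.im| * x) / ‖z‖ * ‖v 0‖ +
          1 / ‖z‖ * M * Q * Real.exp (|z.im| * x) := by
          rw [norm_mul, norm_mul, norm_div]
          gcongr
      _ = _ := by ring
  have hMle : M ≤ ‖u 0‖ + ‖v 0‖ / ‖z‖ + 1 / ‖z‖ * M * Q := by
    calc M = ‖u y‖ * Real.exp (-(|z.im| * y)) := hM
      _ ≤ ((‖u 0‖ + ‖v 0‖ / ‖z‖ + 1 / ‖z‖ * M * Q) * Real.exp (|z.im| * y)) *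
        Real.exp (-(|z.im| * y)) := by gcongr; exact key y hy
      _ = _ := by rw [mul_assoc, ← Real.exp_add]; simp
  have hQz : 1 / ‖z‖ * M * Q ≤ M / 2 := by
    rw [div_mul_eq_mul_div, div_mul_eq_mul_div, div_le_iff₀ hz0]
    nlinarith
  calc ‖u x‖ ≤ M * Real.exp (|z.im| * x) := hMb x hx
    _ ≤ _ := by gcongr; linarith

/-- Asymptotics at the end point `x = 1`. -/
lemma sol_asym (hq : IntervalIntegrable (fun t => (q t : ℂ)) volume 0 1) (a b : ℂ) :
    ∃ C : ℝ, 1 ≤ C ∧ ∀ (z : ℂ) (u v : ℝ → ℂ), CSol q (z ^ 2) u v → u 0 = a → v 0 = b → C ≤ ‖z‖ →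
      (∀ x ∈ Set.Icc (0:ℝ) 1, ‖u x‖ ≤ C * Real.exp (|z.im| * x)) ∧
      ‖u 1 - Complex.cos z * a‖ ≤ C * Real.exp |z.im| / ‖z‖ ∧
      ‖v 1 + z * Complex.sin z * a‖ ≤ C * Real.exp |z.im| ∧
      (a = 0 → ∀ x ∈ Set.Icc (0:ℝ) 1, ‖u x‖ ≤ C * Real.exp (|z.im| * x) / ‖z‖) := by
  set Q := ∫ t in (0:ℝ)..1, ‖(q t : ℂ)‖ with hQ
  have hQ0 : 0 ≤ Q := intervalIntegral.integral_nonneg zero_le_one (fun _ _ => norm_nonneg _)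
  set B := 2 * (‖a‖ + ‖b‖) with hB
  have hB0 : 0 ≤ B := by positivity
  refine ⟨1 + 2 * Q + B + ‖b‖ + B * Q, by
    have := mul_nonneg hB0 hQ0; have := norm_nonneg b; linarith, ?_⟩
  intro z u v h hu hv hC
  have hBQ := mul_nonneg hB0 hQ0
  have hb0 := norm_nonneg b
  have hz1 : 1 ≤ ‖z‖ := by linarith
  have hz2 : 2 * Q ≤ ‖z‖ := by linarith
  have hz0 : 0 < ‖z‖ := by linarith
  have hz : z ≠ 0 := norm_pos_iff.1 hz0
  have sb := fun x hx => sol_bound hq h hz1 hz2 (x := x) hx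
  have hub : ∀ x ∈ Set.Icc (0:ℝ) 1, ‖u x‖ ≤ B * Real.exp (|z.im| * x) := by
    intro x hx
    refine (sb x hx).trans ?_
    rw [hu, hv, hB]
    gcongr
    exact div_le_self hb0 hz1
  have h1 : (1:ℝ) ∈ Set.Icc (0:ℝ) 1 := by simp
  refine ⟨?_, ?_, ?_, ?_⟩
  · intro x hx
    refine (hub x hx).trans ?_
    gcongr; linarith
  · have hvc := var_const1 hz h h1
    have kb := kernel_bound (u := u) (k := fun t : ℝ => Complex.sin (z * (((1:ℝ):ℂ) - t)) / z) hq h1 hB0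
      (c := 1 / ‖z‖) (s := |z.im|) (by positivity) hub (by
        intro t ht
        rw [norm_div, div_mul_eq_mul_div, one_mul]
        gcongr
        have := norm_sin_le_exp (z * (((1:ℝ):ℂ) - t))
        rwa [im_lin z ht.2] at this)
    have e2 := norm_sin_le_exp z
    have e : u 1 - Complex.cos z * a = Complex.sin z / z * b + 
        ∫ t in (0:ℝ)..1, (Complex.sin (z * (((1:ℝ):ℂ) - t)) / z) * ((q t : ℂ) * u t) := by
      rw [hvc, hu, hv]; simp only [Complex.ofReal_one, mul_one]; ring
    rw [e]
    refine (norm_add_le _ _).trans ?_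
    rw [mul_one] at kb
    calc _ ≤ Real.exp |z.im| / ‖z‖ * ‖b‖ + 1 / ‖z‖ * B * Q * Real.exp |z.im| := by
          rw [norm_mul, norm_div]
          gcongr
      _ = (‖b‖ + B * Q) * Real.exp |z.im| / ‖z‖ := by ring
      _ ≤ _ := by gcongr; linarith
  · have hvc := var_const2 h h1
    have kb := kernel_bound (u := u) (k := fun t : ℝ => Complex.cos (z * (((1:ℝ):ℂ) - t))) hq h1 hB0
      (c := 1) (s := |z.im|) (by positivity) hub (by
        intro t ht
        rw [one_mul]
        have := norm_cos_le_exp (z * (((1:ℝ):ℂ) - t))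
        rwa [im_lin z ht.2] at this)
    have e2 := norm_cos_le_exp z
    have e : v 1 + z * Complex.sin z * a = Complex.cos z * b + 
        ∫ t in (0:ℝ)..1, Complex.cos (z * (((1:ℝ):ℂ) - t)) * ((q t : ℂ) * u t) := by
      rw [hvc, hu, hv]; simp only [Complex.ofReal_one, mul_one]; ring
    rw [e]
    refine (norm_add_le _ _).trans ?_
    rw [mul_one] at kb
    calc _ ≤ Real.exp |z.im| * ‖b‖ + 1 * B * Q * Real.exp |z.im| := by
          rw [norm_mul]
          gcongr
      _ = (‖b‖ + B * Q) * Real.exp |z.im| := by ring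
      _ ≤ _ := by gcongr; linarith
  · intro ha x hx
    refine (sb x hx).trans ?_
    rw [hu, hv, ha, norm_zero, zero_add]
    calc 2 * (‖b‖ / ‖z‖) * Real.exp (|z.im| * x) = (2 * ‖b‖) * Real.exp (|z.im| * x) / ‖z‖ := by ring
      _ ≤ _ := by
        gcongr
        have := norm_nonneg a
        linarith

end asym


section boxes

/-- `z` lies on the boundary of the box `[-c,c] × [-d,d]`. -/
def OnBox (c d : ℝ) (z : ℂ) : Prop :=
  (|z.re| = c ∧ |z.im| ≤ d) ∨ (|z.re| ≤ c ∧ |z.im| = d)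

lemma box_max {f : ℂ → ℂ} (hf : Differentiable ℂ f) {c d M : ℝ} (hc : 0 < c) (hd : 0 < d)
    (hb : ∀ z, OnBox c d z → ‖f z‖ ≤ M) {z : ℂ} (h1 : |z.re| ≤ c) (h2 : |z.im| ≤ d) : ‖f z‖ ≤ M := by
  have hc' : -c ≠ c := by intro h; linarith
  have hd' : -d ≠ d := by intro h; linarith
  refine Complex.norm_le_of_forall_mem_frontier_norm_le (U := Set.Ioo (-c) c ×ℂ Set.Ioo (-d) d)
    ((Metric.isBounded_Ioo _ _).reProdIm (Metric.isBounded_Ioo _ _)) hf.diffContOnCl ?_ ?_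
  · intro w hw
    apply hb
    rw [Complex.frontier_reProdIm, closure_Ioo hc', closure_Ioo hd',
      frontier_Ioo (by linarith), frontier_Ioo (by linarith)] at hw
    rcases hw with ⟨h1, h2⟩ | ⟨h1, h2⟩
    · right
      refine ⟨abs_le.2 h1, ?_⟩
      rcases h2 with h2 | h2
      · rw [h2, abs_neg, abs_of_pos hd]
      · rw [h2, abs_of_pos hd]
    · left
      refine ⟨?_, abs_le.2 h2⟩
      rcases h1 with h1 | h1
      · rw [h1, abs_neg, abs_of_pos hc]
      · rw [h1, abs_of_pos hc]
  · rw [Complex.closure_reProdIm, closure_Ioo hc', closure_Ioo hd']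
    exact ⟨abs_le.1 h1, abs_le.1 h2⟩

lemma quot_entire {F G : ℂ → ℂ} (hF : Differentiable ℂ F) (hG : Differentiable ℂ G)
    (hz : ∀ a, G a = 0 → F a = 0 ∧ deriv G a ≠ 0) :
    ∃ H : ℂ → ℂ, Differentiable ℂ H ∧ ∀ a, F a = H a * G a := by
  classical
  refine ⟨fun a => if G a = 0 then deriv F a / deriv G a else F a / G a, ?_, ?_⟩
  · intro a
    by_cases ha : G a = 0
    · obtain ⟨hFa, hGa⟩ := hz a ha
      have dF : Differentiable ℂ (dslope F a) := fun x =>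
        ((Complex.differentiableOn_dslope (s := Set.univ) (by simp)).2 hF.differentiableOn).differentiableAt
          (by simp)
      have dG : Differentiable ℂ (dslope G a) := fun x =>
        ((Complex.differentiableOn_dslope (s := Set.univ) (by simp)).2 hG.differentiableOn).differentiableAt
          (by simp)
      have hne : dslope G a a ≠ 0 := by rwa [dslope_same]
      have hev : ∀ᶠ x in nhds a, dslope G a x ≠ 0 := dG.continuous.continuousAt.eventually_ne hne
      have hq : DifferentiableAt ℂ (fun x => dslope F a x / dslope G a x) a := (dF a).div (dG a) hne
      refine hq.congr_of_eventuallyEq ?_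
      filter_upwards [hev] with x hx
      by_cases hxa : x = a
      · subst hxa
        simp [ha, dslope_same]
      · have e1 := sub_smul_dslope F a x
        have e2 := sub_smul_dslope G a x
        rw [hFa, sub_zero, smul_eq_mul] at e1
        rw [ha, sub_zero, smul_eq_mul] at e2
        have hxa' : x - a ≠ 0 := sub_ne_zero.2 hxa
        have : G x ≠ 0 := by rw [← e2]; exact mul_ne_zero hxa' hx
        rw [if_neg this, ← e1, ← e2, mul_div_mul_left _ _ hxa']
    · have hev : ∀ᶠ x in nhds a, G x ≠ 0 := hG.continuous.continuousAt.eventually_ne ha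
      have hq : DifferentiableAt ℂ (fun x => F x / G x) a := (hF a).div (hG a) ha
      refine hq.congr_of_eventuallyEq ?_
      filter_upwards [hev] with x hx
      rw [if_neg hx]
  · intro a
    by_cases ha : G a = 0
    · simp [ha, (hz a ha).1]
    · simp [ha]

lemma quot_zero {F G : ℂ → ℂ} (hF : Differentiable ℂ F) (hG : Differentiable ℂ G)
    (hz : ∀ a, G a = 0 → F a = 0 ∧ deriv G a ≠ 0)
    (hbox : ∀ ε > 0, ∀ R > 0, ∃ c d : ℝ, R ≤ c ∧ R ≤ d ∧ ∀ z : ℂ, OnBox c d z →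
      G (z ^ 2) ≠ 0 ∧ ‖F (z ^ 2)‖ ≤ ε * ‖G (z ^ 2)‖) : ∀ a, F a = 0 := by
  obtain ⟨H, hH, hFH⟩ := quot_entire hF hG hz
  intro a
  suffices H a = 0 by rw [hFH, this, zero_mul]
  obtain ⟨z, hza⟩ := IsAlgClosed.exists_pow_nat_eq a two_pos
  rw [← norm_le_zero_iff]
  refine le_of_forall_pos_le_add fun ε hε => ?_
  rw [zero_add]
  obtain ⟨c, d, hc, hd, hb⟩ := hbox ε hε (‖z‖ + 1) (by positivity)
  have hK : Differentiable ℂ (fun z => H (z ^ 2)) := hH.comp (differentiable_id.pow 2)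
  have n0 := norm_nonneg z
  have := box_max hK (c := c) (d := d) (M := ε) (by linarith) (by linarith) (fun w hw => by
    obtain ⟨h1, h2⟩ := hb w hw
    rw [hFH, norm_mul] at h2
    exact le_of_mul_le_mul_right h2 (norm_pos_iff.2 h1))
    (z := z) (by linarith [Complex.abs_re_le_norm z]) (by linarith [Complex.abs_im_le_norm z])
  rwa [hza] at this

lemma exp_quarter {y : ℝ} (hy : 1 ≤ y) : Real.exp y / 4 ≤ (Real.exp y - Real.exp (-y)) / 2 := by
  have h1 : Real.exp (-y) * Real.exp y = 1 := by rw [← Real.exp_add]; simp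
  have h2 : 2 ≤ Real.exp y := by linarith [Real.add_one_le_exp y]
  have h3 := Real.exp_pos (-y)
  nlinarith

lemma cosh_ge (y : ℝ) : Real.exp |y| / 4 ≤ Real.cosh y := by
  rw [← Real.cosh_abs, Real.cosh_eq]
  have := Real.exp_pos (-|y|)
  have := Real.exp_pos (|y|)
  linarith

lemma norm_exp_diff {z : ℂ} (hy : 1 ≤ |z.im|) :
    Real.exp |z.im| / 4 ≤ |‖Complex.exp (z * I)‖ - ‖Complex.exp (-z * I)‖| / 2 := by
  refine (exp_quarter hy).trans ?_
  rw [Complex.norm_exp, Complex.norm_exp]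
  simp only [mul_re, I_re, mul_zero, I_im, mul_one, zero_sub, neg_re, neg_im, neg_neg]
  rcases abs_cases z.im with ⟨h, _⟩ | ⟨h, _⟩
  · rw [h, abs_sub_comm]
    gcongr
    exact le_abs_self _
  · rw [h, neg_neg]
    gcongr
    exact le_abs_self _

lemma cos_lower {c d : ℝ} (hd : 1 ≤ d) (hc : |Real.cos c| = 1) {z : ℂ} (hz : OnBox c d z) :
    Real.exp |z.im| / 4 ≤ ‖Complex.cos z‖ := by
  rcases hz with ⟨h1, h2⟩ | ⟨h1, h2⟩
  · refine (cosh_ge z.im).trans ?_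
    refine le_trans ?_ (Complex.abs_re_le_norm _)
    have e : (Complex.cos z).re = Real.cos z.re * Real.cosh z.im := by
      rw [Complex.cos_eq]
      simp [← Complex.ofReal_cos, ← Complex.ofReal_cosh, ← Complex.ofReal_sin, ← Complex.ofReal_sinh]
    rw [e, abs_mul, ← Real.cos_abs z.re, h1, hc, one_mul]
    exact le_abs_self _
  · refine (norm_exp_diff (by rw [h2]; exact hd)).trans ?_
    rw [Complex.cos, norm_div]
    simp only [Complex.norm_ofNat]
    gcongr
    have := abs_norm_sub_norm_le (Complex.exp (z * I)) (-Complex.exp (-z * I))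
    rwa [norm_neg, sub_neg_eq_add] at this

lemma sin_lower {c d : ℝ} (hd : 1 ≤ d) (hc : |Real.sin c| = 1) {z : ℂ} (hz : OnBox c d z) :
    Real.exp |z.im| / 4 ≤ ‖Complex.sin z‖ := by
  rcases hz with ⟨h1, h2⟩ | ⟨h1, h2⟩
  · refine (cosh_ge z.im).trans ?_
    refine le_trans ?_ (Complex.abs_re_le_norm _)
    have e : (Complex.sin z).re = Real.sin z.re * Real.cosh z.im := by
      rw [Complex.sin_eq]
      simp [← Complex.ofReal_cos, ← Complex.ofReal_cosh, ← Complex.ofReal_sin, ← Complex.ofReal_sinh]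
    have e3 : |Real.sin z.re| = 1 := by
      rcases abs_cases z.re with ⟨h, _⟩ | ⟨h, _⟩
      · rw [← h, h1, hc]
      · rw [← abs_neg, ← Real.sin_neg, ← h, h1, hc]
    rw [e, abs_mul, e3, one_mul]
    exact le_abs_self _
  · refine (norm_exp_diff (by rw [h2]; exact hd)).trans ?_
    rw [Complex.sin, norm_div, norm_mul, Complex.norm_I, mul_one]
    simp only [Complex.norm_ofNat]
    gcongr
    have := abs_norm_sub_norm_le (Complex.exp (z * I)) (Complex.exp (-z * I))
    rwa [norm_sub_rev] at this

lemma onBox_norm {c d R : ℝ} (hc : R ≤ c) (hd : R ≤ d) {z : ℂ} (hz : OnBox c d z) : R ≤ ‖z‖ := by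
  rcases hz with ⟨h1, _⟩ | ⟨_, h2⟩
  · exact hc.trans (h1 ▸ Complex.abs_re_le_norm z)
  · exact hd.trans (h2 ▸ Complex.abs_im_le_norm z)

lemma exists_cos_box (R : ℝ) : ∃ c, R ≤ c ∧ |Real.cos c| = 1 := by
  obtain ⟨n, hn⟩ := exists_nat_ge R
  refine ⟨n * Real.pi, ?_, ?_⟩
  · have := Real.pi_gt_three
    have : (0:ℝ) ≤ n := n.cast_nonneg
    nlinarith
  · rw [Real.cos_nat_mul_pi]; simp

lemma exists_sin_box (R : ℝ) : ∃ c, R ≤ c ∧ |Real.sin c| = 1 := by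
  obtain ⟨n, hn⟩ := exists_nat_ge R
  refine ⟨n * Real.pi + Real.pi / 2, ?_, ?_⟩
  · have := Real.pi_gt_three
    have : (0:ℝ) ≤ n := n.cast_nonneg
    nlinarith
  · rw [Real.sin_add_pi_div_two, Real.cos_nat_mul_pi]; simp

/-- `G` of cosine type: vanishing criterion. -/
lemma quot_zero_cos {F G : ℂ → ℂ} (hF : Differentiable ℂ F) (hG : Differentiable ℂ G)
    (hz : ∀ a, G a = 0 → F a = 0 ∧ deriv G a ≠ 0) (C : ℝ) (hC : 1 ≤ C)
    (hGa : ∀ z : ℂ, C ≤ ‖z‖ → ‖G (z ^ 2) - Complex.cos z‖ ≤ C * Real.exp |z.im| / ‖z‖)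
    (hFa : ∀ z : ℂ, C ≤ ‖z‖ → ‖F (z ^ 2)‖ ≤ C * Real.exp |z.im| / ‖z‖) : ∀ a, F a = 0 := by
  refine quot_zero hF hG hz fun ε hε R hR => ?_
  set R' := max R (8 * C + 8 * C / ε) with hR'
  have h8 : 0 < 8 * C / ε := by positivity
  have hR8 : 8 * C + 8 * C / ε ≤ R' := le_max_right _ _
  obtain ⟨c, hc, hc1⟩ := exists_cos_box R'
  refine ⟨c, R', (le_max_left _ _).trans hc, le_max_left _ _, fun z hzb => ?_⟩
  have hn := onBox_norm hc le_rfl hzb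
  have hn0 : 0 < ‖z‖ := by linarith
  have hlow := cos_lower (by linarith) hc1 hzb
  have e1 := hGa z (by linarith)
  have e2 := hFa z (by linarith)
  have hE := Real.exp_pos |z.im|
  have e3 : C * Real.exp |z.im| / ‖z‖ ≤ Real.exp |z.im| / 8 := by
    rw [div_le_iff₀ hn0]; nlinarith
  have e4 : C * Real.exp |z.im| / ‖z‖ ≤ ε * (Real.exp |z.im| / 8) := by
    rw [div_le_iff₀ hn0]
    have : 8 * C ≤ ε * ‖z‖ := by
      have : 8 * C / ε ≤ ‖z‖ := by linarith
      rwa [div_le_iff₀' hε] at this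
    nlinarith
  have e5 : Real.exp |z.im| / 8 ≤ ‖G (z ^ 2)‖ := by
    have := norm_sub_norm_le (Complex.cos z) (G (z ^ 2))
    rw [norm_sub_rev] at this
    linarith
  refine ⟨norm_pos_iff.1 (by linarith), e2.trans (e4.trans ?_)⟩
  gcongr

/-- `G` of sine type: vanishing criterion. -/
lemma quot_zero_sin {F G : ℂ → ℂ} (hF : Differentiable ℂ F) (hG : Differentiable ℂ G)
    (hz : ∀ a, G a = 0 → F a = 0 ∧ deriv G a ≠ 0) (C : ℝ) (hC : 1 ≤ C)
    (hGa : ∀ z : ℂ, C ≤ ‖z‖ → ‖G (z ^ 2) + z * Complex.sin z‖ ≤ C * Real.exp |z.im|)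
    (hFa : ∀ z : ℂ, C ≤ ‖z‖ → ‖F (z ^ 2)‖ ≤ C * Real.exp |z.im|) : ∀ a, F a = 0 := by
  refine quot_zero hF hG hz fun ε hε R hR => ?_
  set R' := max R (8 * C + 8 * C / ε) with hR'
  have h8 : 0 < 8 * C / ε := by positivity
  have hR8 : 8 * C + 8 * C / ε ≤ R' := le_max_right _ _
  obtain ⟨c, hc, hc1⟩ := exists_sin_box R'
  refine ⟨c, R', (le_max_left _ _).trans hc, le_max_left _ _, fun z hzb => ?_⟩
  have hn := onBox_norm hc le_rfl hzb
  have hn0 : 0 < ‖z‖ := by linarith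
  have hlow := sin_lower (by linarith) hc1 hzb
  have e1 := hGa z (by linarith)
  have e2 := hFa z (by linarith)
  have hE := Real.exp_pos |z.im|
  have e3 : C * Real.exp |z.im| ≤ ‖z‖ * (Real.exp |z.im| / 8) := by
    nlinarith
  have e4 : C * Real.exp |z.im| ≤ ε * (‖z‖ * (Real.exp |z.im| / 8)) := by
    have : 8 * C ≤ ε * ‖z‖ := by
      have : 8 * C / ε ≤ ‖z‖ := by linarith
      rwa [div_le_iff₀' hε] at this
    nlinarith
  have e5 : ‖z‖ * (Real.exp |z.im| / 8) ≤ ‖G (z ^ 2)‖ := by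
    have := norm_sub_norm_le (-(z * Complex.sin z)) (G (z ^ 2))
    rw [norm_sub_rev, norm_neg, sub_neg_eq_add, norm_mul] at this
    nlinarith
  have : 0 < ‖z‖ * (Real.exp |z.im| / 8) := by positivity
  refine ⟨norm_pos_iff.1 (by linarith), e2.trans (e4.trans ?_)⟩
  gcongr

end boxes


/-- an entire family of solutions with data `a, b` at the left end -/
structure Fam (q : ℝ → ℝ) (a b : ℂ) (u v : ℂ → ℝ → ℂ) : Prop where
  sol : ∀ lam, CSol q lam (u lam) (v lam)
  u0 : ∀ lam, u lam 0 = a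
  v0 : ∀ lam, v lam 0 = b
  du : ∀ x, Differentiable ℂ (fun lam => u lam x)
  dv : ∀ x, Differentiable ℂ (fun lam => v lam x)
  unif : ∀ lam₀, ∀ ε > 0, ∀ᶠ lam in nhds lam₀, ∀ x, ‖u lam x - u lam₀ x‖ ≤ ε

/-- the characteristic function attached to the right boundary condition -/
def DD (h' : Option ℝ) (a b : ℂ) : ℂ := h'.elim a (fun c => b - c * a)

lemma CSol.wronskian {q : ℝ → ℝ} {lam mu : ℂ} {u v u2 v2 : ℝ → ℂ} (h : CSol q lam u v)
    (h2 : CSol q mu u2 v2) : ∀ x ∈ Set.Icc (0:ℝ) 1,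
    v x * u2 x - u x * v2 x = v 0 * u2 0 - u 0 * v2 0 +
      (mu - lam) * ∫ t in (0:ℝ)..x, u t * u2 t := by
  have e := ((h.2.mul h2.1).sub (h.1.mul h2.2)).congr
    (g := fun t => (mu - lam) * (u t * u2 t)) (fun x _ => by ring) (fun _ _ => rfl)
  intro x hx
  have := e.2 x hx
  rw [intervalIntegral.integral_const_mul] at this
  exact this

lemma IsPrim.conj {f F : ℝ → ℂ} (h : IsPrim f F) :
    IsPrim (fun t => (starRingEnd ℂ) (f t)) (fun t => (starRingEnd ℂ) (F t)) := by
  refine ⟨?_, fun x hx => ?_⟩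
  · have := h.1
    rw [intervalIntegrable_iff] at this ⊢
    refine ⟨Complex.continuous_conj.comp_aestronglyMeasurable this.1, ?_⟩
    refine this.2.congr' ?_
    filter_upwards with t
    simp
  · show (starRingEnd ℂ) (F x) = _
    rw [h.2 x hx, map_add, intervalIntegral.integral_of_le hx.1,
      intervalIntegral.integral_of_le hx.1, integral_conj]

lemma CSol.conj {q : ℝ → ℝ} {lam : ℂ} {u v : ℝ → ℂ} (h : CSol q lam u v) :
    CSol q ((starRingEnd ℂ) lam) (fun t => (starRingEnd ℂ) (u t)) (fun t => (starRingEnd ℂ) (v t)) := by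
  refine ⟨h.1.conj, h.2.conj.congr (fun x _ => ?_) (fun _ _ => rfl)⟩
  simp

lemma int_sq_ne {u : ℝ → ℂ} (hu : ContinuousOn u (Set.Icc 0 1)) (h0 : u 0 = 1) :
    (∫ t in (0:ℝ)..1, u t * (starRingEnd ℂ) (u t)) ≠ 0 := by
  have e : (∫ t in (0:ℝ)..1, u t * (starRingEnd ℂ) (u t)) =
      ((∫ t in (0:ℝ)..1, ‖u t‖ ^ 2 : ℝ) : ℂ) := by
    rw [← intervalIntegral.integral_ofReal]
    congr 1
    ext t
    rw [Complex.mul_conj']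
    push_cast
    rfl
  rw [e]
  have : 0 < ∫ t in (0:ℝ)..1, ‖u t‖ ^ 2 :=
    intervalIntegral.integral_pos zero_lt_one (hu.norm.pow 2) (fun x _ => by positivity)
      ⟨0, by simp, by simp [h0]⟩
  exact_mod_cast this.ne'

section spec
variable {q : ℝ → ℝ} (hq : IntervalIntegrable (fun t => (q t : ℂ)) volume 0 1)
  {h : ℝ} {u v : ℂ → ℝ → ℂ} (hF : Fam q 1 h u v)

lemma Fam.zero_real {q : ℝ → ℝ} {h : ℝ} {u v : ℂ → ℝ → ℂ} (hF : Fam q 1 h u v)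
    (h' : Option ℝ) {lam : ℂ} (hz : DD h' (u lam 1) (v lam 1) = 0) :
    (starRingEnd ℂ) lam = lam := by
  have w := (hF.sol lam).wronskian (hF.sol lam).conj 1 (by simp)
  simp only [hF.u0, hF.v0] at w
  have l : v lam 1 * (starRingEnd ℂ) (u lam 1) - u lam 1 * (starRingEnd ℂ) (v lam 1) = 0 := by
    cases h' with
    | none =>
      have hz : u lam 1 = 0 := hz
      simp [hz]
    | some c =>
      have hz : v lam 1 - c * u lam 1 = 0 := hz
      rw [sub_eq_zero.1 hz]
      simp
      ring
  rw [l] at w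
  simp at w
  rcases w with w | w
  · exact sub_eq_zero.1 w
  · exact absurd w (int_sq_ne (hF.sol lam).1.continuousOn (hF.u0 lam))

lemma Fam.real_val {q : ℝ → ℝ} (hq : IntervalIntegrable (fun t => (q t : ℂ)) volume 0 1)
    {h : ℝ} {u v : ℂ → ℝ → ℂ} (hF : Fam q 1 h u v)
    {lam : ℂ} (hl : (starRingEnd ℂ) lam = lam) : ∀ x ∈ Set.Icc (0:ℝ) 1,
    (starRingEnd ℂ) (u lam x) = u lam x ∧ (starRingEnd ℂ) (v lam x) = v lam x := by
  have e := (hF.sol lam).conj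
  rw [hl] at e
  have := e.eq_mul hq (hF.sol lam) 1 (by simp [hF.u0]) (by simp [hF.v0])
  simpa using this

lemma Fam.tendsto_int {q : ℝ → ℝ} {a b : ℂ} {u v : ℂ → ℝ → ℂ} (hF : Fam q a b u v) (lam : ℂ) :
    Filter.Tendsto (fun mu => ∫ t in (0:ℝ)..1, u lam t * u mu t) (nhds lam)
      (nhds (∫ t in (0:ℝ)..1, u lam t * u lam t)) := by
  obtain ⟨M, hM⟩ := isCompact_Icc.exists_bound_of_continuousOn (hF.sol lam).1.continuousOn
  have hM0 : 0 ≤ M := (norm_nonneg _).trans (hM 0 (by simp))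
  have ii : ∀ mu, IntervalIntegrable (fun t => u lam t * u mu t) volume 0 1 := fun mu => by
    apply ContinuousOn.intervalIntegrable
    rw [Set.uIcc_of_le zero_le_one]
    exact (hF.sol lam).1.continuousOn.mul (hF.sol mu).1.continuousOn
  rw [Metric.tendsto_nhds]
  intro ε hε
  filter_upwards [hF.unif lam (ε / (2 * (M + 1))) (by positivity)] with mu hmu
  rw [dist_eq_norm, ← intervalIntegral.integral_sub (ii mu) (ii lam)]
  have := intervalIntegral.norm_integral_le_of_norm_le_const (a := 0) (b := 1)
    (f := fun t => u lam t * u mu t - u lam t * u lam t) (C := M * (ε / (2 * (M + 1)))) (by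
      intro x hx
      rw [Set.uIoc_of_le zero_le_one] at hx
      rw [← mul_sub, norm_mul]
      exact mul_le_mul (hM x ⟨hx.1.le, hx.2⟩) (hmu x) (norm_nonneg _) hM0)
  refine this.trans_lt ?_
  simp only [sub_zero, abs_one, mul_one]
  have : M * (ε / (2 * (M + 1))) ≤ (M + 1) * (ε / (2 * (M + 1))) := by gcongr; linarith
  refine this.trans_lt ?_
  rw [show (M + 1) * (ε / (2 * (M + 1))) = ε / 2 by field_simp]
  linarith

lemma DD_diff (h' : Option ℝ) {f g : ℂ → ℂ} (hf : Differentiable ℂ f) (hg : Differentiable ℂ g) :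
    Differentiable ℂ (fun lam => DD h' (f lam) (g lam)) := by
  cases h' with
  | none => exact hf
  | some c => exact hg.sub (hf.const_mul _)

lemma Fam.simple {q : ℝ → ℝ} (hq : IntervalIntegrable (fun t => (q t : ℂ)) volume 0 1)
    {h : ℝ} {u v : ℂ → ℝ → ℂ} (hF : Fam q 1 h u v)
    (h' : Option ℝ) {lam : ℂ} (hz : DD h' (u lam 1) (v lam 1) = 0) :
    deriv (fun mu => DD h' (u mu 1) (v mu 1)) lam ≠ 0 := by
  have hl := hF.zero_real h' hz
  have hr := hF.real_val hq hl
  have hJ : (∫ t in (0:ℝ)..1, u lam t * u lam t) ≠ 0 := by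
    have := int_sq_ne (hF.sol lam).1.continuousOn (hF.u0 lam)
    rwa [intervalIntegral.integral_congr (g := fun t => u lam t * u lam t)] at this
    intro x hx
    rw [Set.uIcc_of_le zero_le_one] at hx
    simp only [(hr x hx).1]
  obtain ⟨k, hk⟩ : ∃ k : ℂ, ∀ mu, k * DD h' (u mu 1) (v mu 1) =
      (mu - lam) * ∫ t in (0:ℝ)..1, u lam t * u mu t := by
    cases h' with
    | none =>
      have hz : u lam 1 = 0 := hz
      refine ⟨v lam 1, fun mu => ?_⟩
      have w := (hF.sol lam).wronskian (hF.sol mu) 1 (by simp)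
      simp only [hF.u0, hF.v0, hz] at w
      show v lam 1 * u mu 1 = _
      linear_combination w
    | some c =>
      have hz : v lam 1 - c * u lam 1 = 0 := hz
      refine ⟨- u lam 1, fun mu => ?_⟩
      have w := (hF.sol lam).wronskian (hF.sol mu) 1 (by simp)
      simp only [hF.u0, hF.v0, sub_eq_zero.1 hz] at w
      show - u lam 1 * (v mu 1 - c * u mu 1) = _
      linear_combination w
  have hd := (DD_diff h' (hF.du 1) (hF.dv 1) lam).hasDerivAt.const_mul k
  intro h0
  rw [h0, mul_zero, hasDerivAt_iff_tendsto_slope] at hd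
  have h2 : Filter.Tendsto (slope (fun y => k * DD h' (u y 1) (v y 1)) lam) (nhdsWithin lam {lam}ᶜ)
      (nhds (∫ t in (0:ℝ)..1, u lam t * u lam t)) := by
    refine ((hF.tendsto_int lam).mono_left nhdsWithin_le_nhds).congr' ?_
    filter_upwards [self_mem_nhdsWithin] with mu hmu
    have : mu - lam ≠ 0 := sub_ne_zero.2 hmu
    rw [slope_def_field, hk, hk]
    field_simp
    ring
  exact hJ (tendsto_nhds_unique h2 hd)

end spec


lemma hq_complex {q : ℝ → ℝ} (hq : IntegrableOn q (Set.Icc 0 1)) :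
    IntervalIntegrable (fun t => (q t : ℂ)) volume 0 1 := by
  rw [intervalIntegrable_iff_integrableOn_Icc_of_le zero_le_one]
  exact hq.ofReal

lemma IsPrim.ofReal' {f F : ℝ → ℝ} (h : IsPrim f F) :
    IsPrim (fun t => (f t : ℂ)) (fun t => (F t : ℂ)) := by
  refine ⟨?_, fun x hx => ?_⟩
  · have := h.1
    rw [intervalIntegrable_iff] at this ⊢
    exact this.ofReal
  · show (F x : ℂ) = _
    rw [h.2 x hx, intervalIntegral.integral_ofReal]
    push_cast
    rfl

lemma IsPrim.re' {f F : ℝ → ℂ} (h : IsPrim f F) :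
    IsPrim (fun t => (f t).re) (fun t => (F t).re) := by
  refine ⟨?_, fun x hx => ?_⟩
  · have := h.1
    rw [intervalIntegrable_iff] at this ⊢
    exact this.re
  · show (F x).re = _
    rw [h.2 x hx, Complex.add_re]
    congr 1
    have := intervalIntegral.intervalIntegral_eq_integral_uIoc f 0 x volume
    have h1 := intervalIntegrable_sub01 h.1 hx
    rw [intervalIntegral.integral_of_le hx.1, intervalIntegral.integral_of_le hx.1]
    rw [intervalIntegrable_iff_integrableOn_Ioc_of_le hx.1] at h1
    exact (integral_re h1).symm

lemma mem_spec_iff {q : ℝ → ℝ} (hq : IntegrableOn q (Set.Icc 0 1)) {h : ℝ} {u v : ℂ → ℝ → ℂ}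
    (hF : Fam q 1 h u v) (h' : Option ℝ) (lam : ℝ) :
    lam ∈ SchrodingerSpec q h h' ↔ DD h' (u lam 1) (v lam 1) = 0 := by
  have hqc := hq_complex hq
  constructor
  · rintro ⟨w, w', ⟨-, -, i1, i2, p1, p2⟩, hn, hb0, hb1⟩
    have P1 : IsPrim w' w :=
      ⟨(intervalIntegrable_iff_integrableOn_Icc_of_le zero_le_one).2 i1, p1⟩
    have P2 : IsPrim (fun t => q t * w t - lam * w t) w' :=
      ⟨(intervalIntegrable_iff_integrableOn_Icc_of_le zero_le_one).2 i2, p2⟩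
    have hc : CSol q lam (fun t => (w t : ℂ)) (fun t => (w' t : ℂ)) := by
      refine ⟨P1.ofReal', P2.ofReal'.congr (fun x _ => ?_) (fun _ _ => rfl)⟩
      push_cast
      ring
    have e := hc.eq_mul hqc (hF.sol lam) (w 0) (by simp [hF.u0]) (by
      simp only [hF.v0, hb0]
      push_cast
      ring)
    have hw0 : (w 0 : ℂ) ≠ 0 := by
      intro h0
      apply hn
      intro x hx
      have := (e x hx).1
      rw [h0, zero_mul] at this
      exact_mod_cast this
    obtain ⟨e1, e2⟩ := e 1 (by simp)
    cases h' with
    | none =>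
      have hb1 : w 1 = 0 := hb1
      show u lam 1 = 0
      rw [hb1] at e1
      simpa [hw0] using e1.symm
    | some c =>
      have hb1 : w' 1 = c * w 1 := hb1
      show v lam 1 - c * u lam 1 = 0
      apply mul_left_cancel₀ hw0
      rw [mul_zero, mul_sub, ← e2, hb1]
      push_cast
      linear_combination (-(c:ℂ)) * (-e1)
  · intro hz
    have hs := hF.sol lam
    have hr := hF.real_val hqc (lam := lam) (by simp)
    have hu : ∀ x ∈ Set.Icc (0:ℝ) 1, u lam x = ((u lam x).re : ℂ) := fun x hx =>
      (Complex.conj_eq_iff_re.1 (hr x hx).1).symm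
    have hv : ∀ x ∈ Set.Icc (0:ℝ) 1, v lam x = ((v lam x).re : ℂ) := fun x hx =>
      (Complex.conj_eq_iff_re.1 (hr x hx).2).symm
    have P1 := hs.1.re'
    have P2 := hs.2.re'.congr (g := fun t => q t * (u lam t).re - lam * (u lam t).re)
      (fun x hx => by
        have := hu x hx
        simp
        ring) (fun _ _ => rfl)
    refine ⟨fun x => (u lam x).re, fun x => (v lam x).re, ⟨P1.continuousOn, P2.continuousOn,
      (intervalIntegrable_iff_integrableOn_Icc_of_le zero_le_one).1 P1.1,
      (intervalIntegrable_iff_integrableOn_Icc_of_le zero_le_one).1 P2.1, P1.2, P2.2⟩, ?_, ?_, ?_⟩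
    · intro h0
      have := h0 0 (by simp)
      simp [hF.u0] at this
    · simp [hF.u0, hF.v0]
    · cases h' with
      | none =>
        have hz : u lam 1 = 0 := hz
        show (u lam 1).re = 0
        simp [hz]
      | some c =>
        have hz : v lam 1 - c * u lam 1 = 0 := hz
        show (v lam 1).re = c * (u lam 1).re
        rw [sub_eq_zero.1 hz]
        simp

/-- equal spectra give equal complex zero sets -/
lemma zeros_iff {q qt : ℝ → ℝ} (hq : IntegrableOn q (Set.Icc 0 1))
    (hqt : IntegrableOn qt (Set.Icc 0 1)) {h ht : ℝ} {u v ut vt : ℂ → ℝ → ℂ}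
    (hF : Fam q 1 h u v) (hFt : Fam qt 1 ht ut vt) {h' ht' : Option ℝ}
    (hs : SchrodingerSpec q h h' = SchrodingerSpec qt ht ht') (lam : ℂ) :
    DD h' (u lam 1) (v lam 1) = 0 ↔ DD ht' (ut lam 1) (vt lam 1) = 0 := by
  have key : ∀ l : ℝ, DD h' (u l 1) (v l 1) = 0 ↔ DD ht' (ut l 1) (vt l 1) = 0 := fun l => by
    rw [← mem_spec_iff hq hF, ← mem_spec_iff hqt hFt, hs]
  constructor
  · intro hz
    have := Complex.conj_eq_iff_re.1 (hF.zero_real h' hz)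
    rw [← this] at hz ⊢
    exact (key _).1 hz
  · intro hz
    have := Complex.conj_eq_iff_re.1 (hFt.zero_real ht' hz)
    rw [← this] at hz ⊢
    exact (key _).2 hz

/-- asymptotics at the right end -/
lemma Fam.asym {q : ℝ → ℝ} (hq : IntervalIntegrable (fun t => (q t : ℂ)) volume 0 1)
    {h : ℝ} {u v : ℂ → ℝ → ℂ} (hF : Fam q 1 h u v) : ∃ C, 1 ≤ C ∧ ∀ z : ℂ, C ≤ ‖z‖ →
      (∀ x ∈ Set.Icc (0:ℝ) 1, ‖u (z ^ 2) x‖ ≤ C * Real.exp (|z.im| * x)) ∧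
      ‖u (z ^ 2) 1 - cos z‖ ≤ C * Real.exp |z.im| / ‖z‖ ∧
      ‖v (z ^ 2) 1 + z * sin z‖ ≤ C * Real.exp |z.im| := by
  obtain ⟨C, hC, H⟩ := sol_asym hq 1 h
  refine ⟨C, hC, fun z hz => ?_⟩
  obtain ⟨a, b, c, -⟩ := H z _ _ (hF.sol (z ^ 2)) (hF.u0 _) (hF.v0 _) hz
  rw [mul_one] at b c
  exact ⟨a, b, c⟩

lemma asym_some {q : ℝ → ℝ} (hq : IntervalIntegrable (fun t => (q t : ℂ)) volume 0 1)
    {h : ℝ} {u v : ℂ → ℝ → ℂ} (hF : Fam q 1 h u v) (c : ℝ) : ∃ C, 1 ≤ C ∧ ∀ z : ℂ, C ≤ ‖z‖ →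
      ‖DD (some c) (u (z ^ 2) 1) (v (z ^ 2) 1) + z * sin z‖ ≤ C * Real.exp |z.im| := by
  obtain ⟨C, hC, H⟩ := hF.asym hq
  have : 0 ≤ |c| * C := by positivity
  refine ⟨C + |c| * C, by linarith, fun z hz => ?_⟩
  obtain ⟨a, -, b⟩ := H z (by linarith)
  have a := a 1 (by simp)
  rw [mul_one] at a
  show ‖v (z ^ 2) 1 - c * u (z ^ 2) 1 + z * sin z‖ ≤ _
  calc _ = ‖(v (z ^ 2) 1 + z * sin z) - c * u (z ^ 2) 1‖ := by congr 1; ring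
    _ ≤ ‖v (z ^ 2) 1 + z * sin z‖ + ‖c * u (z ^ 2) 1‖ := norm_sub_le _ _
    _ ≤ C * Real.exp |z.im| + |c| * (C * Real.exp |z.im|) := by
      rw [norm_mul, Complex.norm_real, Real.norm_eq_abs]
      gcongr
    _ = _ := by ring

/-- no function of cosine type vanishes identically -/
lemma not_zero_cos {F : ℂ → ℂ} {C : ℝ} (hC : 1 ≤ C)
    (hFa : ∀ z : ℂ, C ≤ ‖z‖ → ‖F (z ^ 2) - cos z‖ ≤ C * Real.exp |z.im| / ‖z‖) :
    ∀ M : ℝ, ∃ y : ℝ, M ≤ y ∧ 1 ≤ y ∧ ∃ lam, lam = ((y : ℂ) * I) ^ 2 ∧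
      Real.exp y / 8 ≤ ‖F lam‖ := by
  intro M
  set y := max M (8 * C) with hy
  have h8 : 8 * C ≤ y := le_max_right _ _
  have y0 : 0 < y := by linarith
  refine ⟨y, le_max_left _ _, by linarith, _, rfl, ?_⟩
  have n : ‖(y : ℂ) * I‖ = y := by simp [abs_of_pos y0]
  have m : ((y : ℂ) * I).im = y := by simp
  have := hFa (y * I) (by rw [n]; linarith)
  rw [n, m, abs_of_pos y0, Complex.cos_mul_I, ← Complex.ofReal_cosh] at this
  have t := norm_sub_norm_le ((Real.cosh y : ℝ) : ℂ) (F ((y * I) ^ 2))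
  rw [norm_sub_rev, Complex.norm_real, Real.norm_eq_abs, abs_of_pos (Real.cosh_pos y)] at t
  have c := cosh_ge y
  rw [abs_of_pos y0] at c
  have : C * Real.exp y / y ≤ Real.exp y / 8 := by
    rw [div_le_div_iff₀ y0 (by norm_num)]
    nlinarith [Real.exp_pos y]
  linarith



lemma mixed_false {q qt : ℝ → ℝ} (hq : IntervalIntegrable (fun t => (q t : ℂ)) volume 0 1)
    (hqt : IntervalIntegrable (fun t => (qt t : ℂ)) volume 0 1)
    {h ht : ℝ} {u v ut vt : ℂ → ℝ → ℂ}
    (hF : Fam q 1 h u v) (hFt : Fam qt 1 ht ut vt) {c : ℝ}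
    (hz : ∀ lam, DD (some c) (ut lam 1) (vt lam 1) = 0 → u lam 1 = 0) : False := by
  obtain ⟨C, hC, H⟩ := hF.asym hq
  obtain ⟨C', hC', H'⟩ := asym_some hqt hFt c
  have key := quot_zero_sin (F := fun lam => u lam 1)
    (G := fun lam => DD (some c) (ut lam 1) (vt lam 1)) (hF.du 1)
    (DD_diff _ (hFt.du 1) (hFt.dv 1)) (fun a ha => ⟨hz a ha, hFt.simple hqt (some c) ha⟩)
    (C + C') (by linarith) (fun z hzz => (H' z (by linarith)).trans (by gcongr; linarith))
    (fun z hzz => by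
      have := (H z (by linarith)).1 1 (by simp)
      rw [mul_one] at this
      exact this.trans (by gcongr; linarith))
  obtain ⟨y, -, -, lam, -, hy⟩ := not_zero_cos (F := fun lam => u lam 1) hC
    (fun z hz => (H z hz).2.1) 0
  simp only [key lam, norm_zero] at hy
  have := Real.exp_pos y
  linarith

lemma eq_D {q qt : ℝ → ℝ} (hq : IntervalIntegrable (fun t => (q t : ℂ)) volume 0 1)
    (hqt : IntervalIntegrable (fun t => (qt t : ℂ)) volume 0 1)
    {h ht : ℝ} {u v ut vt : ℂ → ℝ → ℂ}
    (hF : Fam q 1 h u v) (hFt : Fam qt 1 ht ut vt) {h' ht' : Option ℝ}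
    (hz : ∀ lam, DD h' (u lam 1) (v lam 1) = 0 ↔ DD ht' (ut lam 1) (vt lam 1) = 0) :
    (∀ lam, DD h' (u lam 1) (v lam 1) = DD ht' (ut lam 1) (vt lam 1)) ∧
      (h' = none ↔ ht' = none) := by
  have hzz : ∀ a, DD h' (u a 1) (v a 1) = 0 →
      DD ht' (ut a 1) (vt a 1) - DD h' (u a 1) (v a 1) = 0 ∧
        deriv (fun mu => DD h' (u mu 1) (v mu 1)) a ≠ 0 := fun a ha =>
    ⟨by rw [ha, (hz a).1 ha, sub_zero], hF.simple hq h' ha⟩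
  have d1 : Differentiable ℂ (fun mu => DD h' (u mu 1) (v mu 1)) := DD_diff _ (hF.du 1) (hF.dv 1)
  have d2 : Differentiable ℂ (fun mu => DD ht' (ut mu 1) (vt mu 1)) :=
    DD_diff _ (hFt.du 1) (hFt.dv 1)
  cases h' with
  | none =>
    cases ht' with
    | none =>
      refine ⟨?_, by simp⟩
      obtain ⟨C, hC, H⟩ := hF.asym hq
      obtain ⟨C', hC', H'⟩ := hFt.asym hqt
      have key := quot_zero_cos (d2.sub d1) d1 hzz (C + C') (by linarith)
        (fun z hzn => (H z (by linarith)).2.1.trans (by gcongr; linarith))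
        (fun z hzn => by
          have e1 := (H z (by linarith)).2.1
          have e2 := (H' z (by linarith)).2.1
          show ‖ut (z ^ 2) 1 - u (z ^ 2) 1‖ ≤ _
          calc _ = ‖(ut (z ^ 2) 1 - cos z) - (u (z ^ 2) 1 - cos z)‖ := by congr 1; ring
            _ ≤ _ := norm_sub_le _ _
            _ ≤ _ := add_le_add e2 e1
            _ = _ := by ring)
      exact fun lam => (sub_eq_zero.1 (key lam)).symm
    | some c => exact (mixed_false hq hqt hF hFt (fun lam => (hz lam).2)).elim
  | some c =>
    cases ht' with
    | none => exact (mixed_false hqt hq hFt hF (fun lam => (hz lam).1)).elim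
    | some ct =>
      refine ⟨?_, by simp⟩
      obtain ⟨C, hC, H⟩ := asym_some hq hF c
      obtain ⟨C', hC', H'⟩ := asym_some hqt hFt ct
      have key := quot_zero_sin (d2.sub d1) d1 hzz (C + C') (by linarith)
        (fun z hzn => (H z (by linarith)).trans (by gcongr; linarith))
        (fun z hzn => by
          have e1 := H z (by linarith)
          have e2 := H' z (by linarith)
          show ‖DD (some ct) (ut (z ^ 2) 1) (vt (z ^ 2) 1) -
            DD (some c) (u (z ^ 2) 1) (v (z ^ 2) 1)‖ ≤ _
          calc _ = ‖(DD (some ct) (ut (z ^ 2) 1) (vt (z ^ 2) 1) + z * sin z) -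
              (DD (some c) (u (z ^ 2) 1) (v (z ^ 2) 1) + z * sin z)‖ := by congr 1; ring
            _ ≤ _ := norm_sub_le _ _
            _ ≤ _ := add_le_add e2 e1
            _ = _ := by ring)
      exact fun lam => (sub_eq_zero.1 (key lam)).symm

lemma combine {q qt : ℝ → ℝ} (hq : IntervalIntegrable (fun t => (q t : ℂ)) volume 0 1)
    (hqt : IntervalIntegrable (fun t => (qt t : ℂ)) volume 0 1)
    {h ht : ℝ} {u v ut vt : ℂ → ℝ → ℂ}
    (hF : Fam q 1 h u v) (hFt : Fam qt 1 ht ut vt) {h₁ h₂ ht₁ ht₂ : Option ℝ} (hne : h₁ ≠ h₂)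
    (e1 : ∀ lam, DD h₁ (u lam 1) (v lam 1) = DD ht₁ (ut lam 1) (vt lam 1))
    (t1 : h₁ = none ↔ ht₁ = none)
    (e2 : ∀ lam, DD h₂ (u lam 1) (v lam 1) = DD ht₂ (ut lam 1) (vt lam 1))
    (t2 : h₂ = none ↔ ht₂ = none) :
    (∀ lam, u lam 1 = ut lam 1) ∧ (∀ lam, u lam 1 = 0 → v lam 1 = vt lam 1) := by
  rcases h₁ with _ | c1
  · rcases h₂ with _ | c2
    · exact absurd rfl hne
    · rcases ht₁ with _ | ct1
      swap
      · simp at t1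
      rcases ht₂ with _ | ct2
      · simp at t2
      have e1 : ∀ lam, u lam 1 = ut lam 1 := e1
      have e2 : ∀ lam, v lam 1 - c2 * u lam 1 = vt lam 1 - ct2 * ut lam 1 := e2
      refine ⟨e1, fun lam h0 => ?_⟩
      have := e2 lam
      rw [← e1, h0] at this
      simpa using this
  · rcases ht₁ with _ | ct1
    · simp at t1
    have e1 : ∀ lam, v lam 1 - c1 * u lam 1 = vt lam 1 - ct1 * ut lam 1 := e1
    rcases h₂ with _ | c2
    · rcases ht₂ with _ | ct2
      swap
      · simp at t2
      have e2 : ∀ lam, u lam 1 = ut lam 1 := e2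
      refine ⟨e2, fun lam h0 => ?_⟩
      have := e1 lam
      rw [← e2, h0] at this
      simpa using this
    · rcases ht₂ with _ | ct2
      · simp at t2
      have e2 : ∀ lam, v lam 1 - c2 * u lam 1 = vt lam 1 - ct2 * ut lam 1 := e2
      have hd : c2 - c1 ≠ 0 := fun h => hne (by rw [sub_eq_zero.1 h])
      have e3 : ∀ lam, ((c2 - c1 : ℝ) : ℂ) * u lam 1 = ((ct2 - ct1 : ℝ) : ℂ) * ut lam 1 := by
        intro lam
        push_cast
        linear_combination e1 lam - e2 lam
      generalize c2 - c1 = d at hd e3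
      generalize ct2 - ct1 = dt at e3
      have hdd : d = dt := by
        by_contra hn
        have hp : 0 < |d - dt| := abs_pos.2 (sub_ne_zero.2 hn)
        obtain ⟨C, hC, H⟩ := hF.asym hq
        obtain ⟨C', hC', H'⟩ := hFt.asym hqt
        obtain ⟨y, hy1, hy0, lam, rfl, hy⟩ := not_zero_cos (F := fun lam => u lam 1) hC
          (fun z hz => (H z hz).2.1) (C + C' + 8 * (|dt| * (C + C')) / |d - dt| + 1)
        have p0 : 0 ≤ 8 * (|dt| * (C + C')) / |d - dt| := by positivity
        have y0 : 0 < y := by linarith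
        have n : ‖(y : ℂ) * I‖ = y := by simp [abs_of_pos y0]
        have m : ((y : ℂ) * I).im = y := by simp
        have f1 := (H (y * I) (by rw [n]; linarith)).2.1
        have f2 := (H' (y * I) (by rw [n]; linarith)).2.1
        rw [n, m, abs_of_pos y0] at f1 f2
        have e := e3 ((y * I) ^ 2)
        generalize ((y : ℂ) * I) ^ 2 = l at *
        have f3 : ‖((d - dt : ℝ) : ℂ) * u l 1‖ ≤ |dt| * ((C + C') * Real.exp y / y) := by
          have : ((d - dt : ℝ) : ℂ) * u l 1 =
              (dt : ℂ) * ((ut l 1 - cos (y * I)) - (u l 1 - cos (y * I))) := by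
            push_cast
            linear_combination e
          rw [this, norm_mul, Complex.norm_real, Real.norm_eq_abs]
          gcongr
          calc _ ≤ _ := norm_sub_le _ _
            _ ≤ _ := add_le_add f2 f1
            _ = _ := by ring
        rw [norm_mul, Complex.norm_real, Real.norm_eq_abs] at f3
        have f4 : |d - dt| * (Real.exp y / 8) ≤ |dt| * ((C + C') * Real.exp y / y) :=
          le_trans (by gcongr) f3
        have f5 : 8 * (|dt| * (C + C')) < y * |d - dt| := by
          rw [← div_lt_iff₀ hp]
          linarith
        have ep := Real.exp_pos y
        rw [show |dt| * ((C + C') * Real.exp y / y) = (|dt| * (C + C')) / y * Real.exp y by ring,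
          show |d - dt| * (Real.exp y / 8) = |d - dt| / 8 * Real.exp y by ring] at f4
        have f6 := le_of_mul_le_mul_right f4 ep
        rw [div_le_div_iff₀ (by norm_num) y0] at f6
        linarith
      have e4 : ∀ lam, u lam 1 = ut lam 1 := fun lam => by
        have := e3 lam
        rw [← hdd] at this
        exact mul_left_cancel₀ (by exact_mod_cast hd) this
      refine ⟨e4, fun lam h0 => ?_⟩
      have := e1 lam
      rw [← e4, h0] at this
      simpa using this



lemma IsPrim.refl1 {f F : ℝ → ℂ} (h : IsPrim f F) :
    IsPrim (fun t => -f (1 - t)) (fun t => F (1 - t)) := by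
  refine ⟨?_, fun x hx => ?_⟩
  · have := (h.1.comp_sub_left 1).symm
    simp only [sub_zero, sub_self] at this
    exact this.neg
  · have hx' : 1 - x ∈ Set.Icc (0:ℝ) 1 := ⟨by linarith [hx.2], by linarith [hx.1]⟩
    have e1 := h.2 (1 - x) hx'
    have e2 := h.2 1 (by simp)
    show F (1 - x) = F (1 - 0) + ∫ t in (0:ℝ)..x, -f (1 - t)
    rw [intervalIntegral.integral_neg, intervalIntegral.integral_comp_sub_left f 1, sub_zero, e1, e2,
      ← intervalIntegral.integral_add_adjacent_intervals (intervalIntegrable_sub01 h.1 hx')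
        ((intervalIntegrable_sub01 h.1 hx').symm.trans h.1)]
    ring

lemma CSol.refl1 {q : ℝ → ℝ} {lam : ℂ} {u v : ℝ → ℂ} (h : CSol (fun t => q (1 - t)) lam u v) :
    CSol q lam (fun x => - u (1 - x)) (fun x => v (1 - x)) := by
  constructor
  · exact (h.1.refl1.const_mul (-1)).congr (fun x _ => by ring) (fun x _ => by ring)
  · refine h.2.refl1.congr (fun x _ => ?_) (fun _ _ => rfl)
    simp only [sub_sub_cancel]
    ring

lemma hq_refl {q : ℝ → ℝ} (hq : IntervalIntegrable (fun t => (q t : ℂ)) volume 0 1) :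
    IntervalIntegrable (fun t => (q (1 - t) : ℂ)) volume 0 1 := by
  have := (hq.comp_sub_left 1).symm
  simpa using this

/-- uniqueness from data at the right end -/
lemma CSol.eq_mul_right {q : ℝ → ℝ} (hq : IntervalIntegrable (fun t => (q t : ℂ)) volume 0 1)
    {lam : ℂ} {u v u2 v2 : ℝ → ℂ} (h : CSol q lam u v) (h2 : CSol q lam u2 v2) (c : ℂ)
    (e1 : u 1 = c * u2 1) (e2 : v 1 = c * v2 1) :
    ∀ x ∈ Set.Icc (0:ℝ) 1, u x = c * u2 x := by
  have hh : q = fun t => (fun s => q (1 - s)) (1 - t) := by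
    ext t
    simp
  have r1 : CSol (fun s => q (1 - s)) lam _ _ := CSol.refl1 (hh ▸ h)
  have r2 : CSol (fun s => q (1 - s)) lam _ _ := CSol.refl1 (hh ▸ h2)
  intro x hx
  have := (r1.eq_mul (hq_refl hq) r2 c (by simp [e1]) (by simp [e2]) (1 - x)
    ⟨by linarith [hx.2], by linarith [hx.1]⟩).1
  simp only [sub_sub_cancel] at this
  linear_combination -this

lemma exists_right {q : ℝ → ℝ} (hq : IntervalIntegrable (fun t => (q t : ℂ)) volume 0 1) :
    ∃ s s' : ℂ → ℝ → ℂ, (∀ lam, CSol q lam (s lam) (s' lam)) ∧ (∀ lam, s lam 1 = 0) ∧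
      (∀ lam, s' lam 1 = 1) ∧ (∀ x, Differentiable ℂ (fun lam => s lam x)) ∧
      ∃ C, 1 ≤ C ∧ ∀ z : ℂ, C ≤ ‖z‖ → ∀ x ∈ Set.Icc (0:ℝ) 1,
        ‖s (z ^ 2) x‖ ≤ C * Real.exp (|z.im| * (1 - x)) / ‖z‖ := by
  obtain ⟨u, v, h1, h2, h3, h4, -, -⟩ := exists_CSol (hq_refl hq) 0 1
  obtain ⟨C, hC, H⟩ := sol_asym (hq_refl hq) 0 1
  refine ⟨fun lam x => - u lam (1 - x), fun lam x => v lam (1 - x), fun lam => (h1 lam).refl1,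
    fun lam => by simp [h2], fun lam => by simp [h3], fun x => (h4 (1 - x)).neg, C, hC, ?_⟩
  intro z hz x hx
  rw [norm_neg]
  exact (H z _ _ (h1 _) (h2 _) (h3 _) hz).2.2.2 rfl _ ⟨by linarith [hx.2], by linarith [hx.1]⟩

lemma sq_lemma {q qt : ℝ → ℝ} {lam : ℂ} {s s' st st' : ℝ → ℂ} (h : CSol q lam s s')
    (ht : CSol qt lam st st') (e : ∀ x ∈ Set.Icc (0:ℝ) 1, s x * s x = st x * st x) :
    (∀ x ∈ Set.Icc (0:ℝ) 1, s x * s' x = st x * st' x) ∧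
      ∀ᵐ x : ℝ, x ∈ Set.Icc (0:ℝ) 1 → s x ≠ 0 → q x = qt x := by
  have c1 := h.1.continuousOn
  have c2 := h.2.continuousOn
  have c3 := ht.1.continuousOn
  have c4 := ht.2.continuousOn
  have E : ∀ x ∈ Set.Icc (0:ℝ) 1, s x * s' x = st x * st' x := by
    intro x hx
    have := (h.1.mul h.1).unique (ht.1.mul ht.1) e ((c2.mul c1).add (c1.mul c2))
      ((c4.mul c3).add (c3.mul c4)) x hx
    linear_combination this / 2
  refine ⟨E, ?_⟩
  filter_upwards [(h.1.mul h.2).ae_unique (ht.1.mul ht.2) E] with x hx hI hs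
  have a := hx hI
  have b := E x hI
  have c := e x hI
  have d : s' x * s' x = st' x * st' x := by
    apply mul_left_cancel₀ (mul_ne_zero hs hs)
    linear_combination (s x * s' x + st x * st' x) * b - st' x * st' x * c
  have f : (q x : ℂ) = qt x := by
    apply mul_right_cancel₀ (mul_ne_zero hs hs)
    linear_combination a - d - (qt x - lam) * c
  exact_mod_cast f

lemma final_core {q qt : ℝ → ℝ} (hq : IntervalIntegrable (fun t => (q t : ℂ)) volume 0 1)
    (hqt : IntervalIntegrable (fun t => (qt t : ℂ)) volume 0 1)
    {h ht : ℝ} {u v ut vt : ℂ → ℝ → ℂ}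
    (hF : Fam q 1 h u v) (hFt : Fam qt 1 ht ut vt)
    (e1 : ∀ lam, u lam 1 = ut lam 1) (e2 : ∀ lam, u lam 1 = 0 → v lam 1 = vt lam 1) :
    (∀ᵐ x : ℝ, x ∈ Set.Icc (0:ℝ) 1 → q x = qt x) ∧ h = ht ∧
      ∃ lam, u lam 1 ≠ 0 ∧ v lam 1 = vt lam 1 := by
  obtain ⟨s, s', hs, s1, s1', ds, Cs, hCs, bs⟩ := exists_right hq
  obtain ⟨st, st', hst, st1, st1', dst, Cst, hCst, bst⟩ := exists_right hqt
  obtain ⟨C, hC, H⟩ := hF.asym hq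
  obtain ⟨Ct, hCt, Ht⟩ := hFt.asym hqt
  have key : ∀ x ∈ Set.Icc (0:ℝ) 1, ∀ lam, u lam x * st lam x - ut lam x * s lam x = 0 := by
    intro x hx
    have p1 : 1 ≤ C * Cst := one_le_mul_of_one_le_of_one_le hC hCst
    have p2 : 1 ≤ Ct * Cs := one_le_mul_of_one_le_of_one_le hCt hCs
    refine quot_zero_cos (F := fun lam => u lam x * st lam x - ut lam x * s lam x)
      (G := fun lam => u lam 1) (((hF.du x).mul (dst x)).sub ((hFt.du x).mul (ds x))) (hF.du 1)
      ?_ (C + Ct + Cs + Cst + C * Cst + Ct * Cs) (by linarith) ?_ ?_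
    · intro a ha
      refine ⟨?_, hF.simple hq none ha⟩
      have f1 := (hF.sol a).eq_mul_right hq (hs a) (v a 1) (by rw [ha, s1, mul_zero])
        (by rw [s1', mul_one]) x hx
      have f2 := (hFt.sol a).eq_mul_right hqt (hst a) (vt a 1)
        (by rw [← e1, ha, st1, mul_zero]) (by rw [st1', mul_one]) x hx
      show u a x * st a x - ut a x * s a x = 0
      rw [f1, f2, e2 a ha]
      ring
    · intro z hz
      refine (H z (by linarith)).2.1.trans ?_
      gcongr
      linarith
    · intro z hz
      have n0 : 0 < ‖z‖ := by linarith
      have g1 := (H z (by linarith)).1 x hx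
      have g2 := (Ht z (by linarith)).1 x hx
      have g3 := bs z (by linarith) x hx
      have g4 := bst z (by linarith) x hx
      have ee : Real.exp (|z.im| * x) * Real.exp (|z.im| * (1 - x)) = Real.exp |z.im| := by
        rw [← Real.exp_add]
        congr 1
        ring
      calc _ ≤ ‖u (z ^ 2) x * st (z ^ 2) x‖ + ‖ut (z ^ 2) x * s (z ^ 2) x‖ := norm_sub_le _ _
        _ ≤ (C * Real.exp (|z.im| * x)) * (Cst * Real.exp (|z.im| * (1 - x)) / ‖z‖) +
            (Ct * Real.exp (|z.im| * x)) * (Cs * Real.exp (|z.im| * (1 - x)) / ‖z‖) := by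
          rw [norm_mul, norm_mul]
          gcongr
        _ = (C * Cst + Ct * Cs) * (Real.exp (|z.im| * x) * Real.exp (|z.im| * (1 - x))) / ‖z‖ := by
          ring
        _ ≤ _ := by
          rw [ee]
          gcongr
          linarith
  obtain ⟨y, -, -, lam, -, hy⟩ := not_zero_cos (F := fun lam => u lam 1) hC
    (fun z hz => (H z hz).2.1) 0
  have hw : u lam 1 ≠ 0 := by
    intro h0
    simp only [h0, norm_zero] at hy
    have := Real.exp_pos y
    linarith
  have A : ∀ x ∈ Set.Icc (0:ℝ) 1, u lam x * st lam x = ut lam x * s lam x := fun x hx =>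
    sub_eq_zero.1 (key x hx lam)
  have cu := (hF.sol lam).1.continuousOn
  have cv := (hF.sol lam).2.continuousOn
  have cut := (hFt.sol lam).1.continuousOn
  have cvt := (hFt.sol lam).2.continuousOn
  have cs := (hs lam).1.continuousOn
  have cs' := (hs lam).2.continuousOn
  have cst := (hst lam).1.continuousOn
  have cst' := (hst lam).2.continuousOn
  have A' := ((hF.sol lam).1.mul (hst lam).1).unique ((hFt.sol lam).1.mul (hs lam).1) A
    ((cv.mul cst).add (cu.mul cst')) ((cvt.mul cs).add (cut.mul cs'))
  have wron : ∀ {p : ℝ → ℝ} {f f' g g' : ℝ → ℂ}, CSol p lam f f' → CSol p lam g g' → g 1 = 0 →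
      g' 1 = 1 → ∀ x ∈ Set.Icc (0:ℝ) 1, f' x * g x - f x * g' x = - f 1 := by
    intro p f f' g g' h1 h2 h3 h4 x hx
    have a := h1.wronskian h2 x hx
    have b := h1.wronskian h2 1 (by simp)
    rw [h3, h4] at b
    linear_combination a - b
  have W := wron (hF.sol lam) (hs lam) (s1 lam) (s1' lam)
  have Wt := wron (hFt.sol lam) (hst lam) (st1 lam) (st1' lam)
  rw [← e1] at Wt
  have S2 : ∀ x ∈ Set.Icc (0:ℝ) 1, s lam x * s lam x = st lam x * st lam x := by
    intro x hx
    have a := A x hx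
    have a' := A' x hx
    have w := W x hx
    have wt := Wt x hx
    apply mul_left_cancel₀ hw
    linear_combination -(st lam x * st lam x) * w + (s lam x * s lam x) * wt
      + s lam x * st lam x * a' - (st lam x * s' lam x + s lam x * st' lam x) * a
  have U2 : ∀ x ∈ Set.Icc (0:ℝ) 1, u lam x * u lam x = ut lam x * ut lam x := by
    intro x hx
    have a := A x hx
    have a' := A' x hx
    have w := W x hx
    have wt := Wt x hx
    apply mul_left_cancel₀ hw
    linear_combination -(ut lam x * ut lam x) * w + (u lam x * u lam x) * wt
      + u lam x * ut lam x * a' - (ut lam x * v lam x + u lam x * vt lam x) * a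
  obtain ⟨Se, Sq⟩ := sq_lemma (hs lam) (hst lam) S2
  obtain ⟨Ue, Uq⟩ := sq_lemma (hF.sol lam) (hFt.sol lam) U2
  refine ⟨?_, ?_, lam, hw, ?_⟩
  · filter_upwards [Sq, Uq] with x h1 h2 hx
    by_cases h0 : s lam x = 0
    · refine h2 hx fun h00 => hw ?_
      have := W x hx
      rw [h0, h00] at this
      linear_combination this
    · exact h1 hx h0
  · have := Ue 0 (by simp)
    rw [hF.u0, hF.v0, hFt.u0, hFt.v0, one_mul, one_mul] at this
    exact_mod_cast this
  · have := Ue 1 (by simp)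
    rw [← e1] at this
    exact mul_left_cancel₀ hw this

theorem stmt13 (q qt : ℝ → ℝ)
    (hq : IntegrableOn q (Set.Icc 0 1)) (hqt : IntegrableOn qt (Set.Icc 0 1))
    (h ht : ℝ) (h₁ h₂ ht₁ ht₂ : Option ℝ) (hne : h₁ ≠ h₂)
    (hs1 : SchrodingerSpec q h h₁ = SchrodingerSpec qt ht ht₁)
    (hs2 : SchrodingerSpec q h h₂ = SchrodingerSpec qt ht ht₂) :
    (∀ᵐ x ∂(volume.restrict (Set.Ioo (0:ℝ) 1)), q x = qt x) ∧
    h = ht ∧ h₁ = ht₁ ∧ h₂ = ht₂ := by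
  have hqc := hq_complex hq
  have hqtc := hq_complex hqt
  obtain ⟨u, v, a1, a2, a3, a4, a5, a6⟩ := exists_CSol hqc 1 h
  obtain ⟨ut, vt, b1, b2, b3, b4, b5, b6⟩ := exists_CSol hqtc 1 ht
  have hF : Fam q 1 h u v := ⟨a1, a2, a3, a4, a5, a6⟩
  have hFt : Fam qt 1 ht ut vt := ⟨b1, b2, b3, b4, b5, b6⟩
  obtain ⟨d1, t1⟩ := eq_D hqc hqtc hF hFt (zeros_iff hq hqt hF hFt hs1)
  obtain ⟨d2, t2⟩ := eq_D hqc hqtc hF hFt (zeros_iff hq hqt hF hFt hs2)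
  obtain ⟨e1, e2⟩ := combine hqc hqtc hF hFt hne d1 t1 d2 t2
  obtain ⟨r1, r2, lam, r3, r4⟩ := final_core hqc hqtc hF hFt e1 e2
  have fin : ∀ {k kt : Option ℝ}, (∀ lam, DD k (u lam 1) (v lam 1) = DD kt (ut lam 1) (vt lam 1)) →
      (k = none ↔ kt = none) → k = kt := by
    intro k kt d t
    cases k with
    | none => exact (t.1 rfl).symm
    | some c =>
      cases kt with
      | none => simp at t
      | some ct =>
        have := d lam
        change v lam 1 - c * u lam 1 = vt lam 1 - ct * ut lam 1 at this
        rw [← e1, ← r4] at this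
        have h3 : (c : ℂ) = ct := mul_right_cancel₀ r3 (by linear_combination -this)
        have h4 : c = ct := by exact_mod_cast h3
        rw [h4]
  refine ⟨?_, r2, fin d1 t1, fin d2 t2⟩
  rw [ae_restrict_iff' measurableSet_Ioo]
  filter_upwards [r1] with x hx hI
  exact hx ⟨hI.1.le, hI.2.le⟩

end
end
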